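/- The forgetful map f_3(S²) : PConf_4(S²) → PConf_3(S²) admits a continuous section, and any two continuous sections of f_3(S²) are homotopic as continuous maps PConf_3(S²) → PConf_4(S²); that is, f_3(S²) has a unique continuous section up to homotopy. -/

import Mathlib

/-- The ordered configuration space of `n` points in `S`. -/
abbrev PConf (n : ℕ) (S : Type*) : Type _ := {x : Fin n → S // Function.Injective x}

/-- The forgetful map `f_n(S)` forgetting the 0th point. -/
def forgetPoint (n : ℕ) {S : Type*} (x : PConf (n + 1) S) : PConf n S :=
  ⟨x.1 ∘ Fin.succ, x.2.comp (Fin.succ_injective n)⟩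

/-- The unit 2-sphere in `ℝ³`. -/
abbrev Sphere2 : Type _ := (Metric.sphere (0 : EuclideanSpace ℝ (Fin 3)) 1 : Set _)

open Set Filter Topology unitInterval

/-- The plane punctured at `(0, 0)` and `(1, 0)`. -/
def puncturedPlane : Set (ℝ × ℝ) := {z | z.1 = 0 ∨ z.1 = 1 → z.2 ≠ 0}

/-- The plane without the two downward closed vertical rays starting at the punctures. -/
def upperChart : Set (ℝ × ℝ) := {z | z.1 = 0 ∨ z.1 = 1 → 0 < z.2}

/-- The plane without the two upward closed vertical rays starting at the punctures. -/
def lowerChart : Set (ℝ × ℝ) := {z | z.1 = 0 ∨ z.1 = 1 → z.2 < 0}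

/-- The projections to the first axis of the three strips forming
`upperChart ∩ lowerChart`. -/
def stripBase : Fin 3 → Set ℝ := ![Iio 0, Ioo 0 1, Ioi 1]

/-- The index of the strip above a point of the first axis. -/
noncomputable def stripIndex (x : ℝ) : Fin 3 := if x < 0 then 0 else if x < 1 then 1 else 2

lemma upperChart_subset : upperChart ⊆ puncturedPlane := fun _ hz h => (hz h).ne'

lemma isClosed_walls : IsClosed {z : ℝ × ℝ | z.1 = 0 ∨ z.1 = 1} :=
  (isClosed_eq continuous_fst continuous_const).union
    (isClosed_eq continuous_fst continuous_const)

lemma isOpen_upperChart : IsOpen upperChart := by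
  have : upperChart = {z : ℝ × ℝ | z.1 = 0 ∨ z.1 = 1}ᶜ ∪ {z | 0 < z.2} := by
    ext z; simp only [upperChart, mem_ofPred_eq, mem_union, mem_compl_iff]; tauto
  rw [this]
  exact isClosed_walls.isOpen_compl.union (isOpen_lt continuous_const continuous_snd)

lemma isOpen_lowerChart : IsOpen lowerChart := by
  have : lowerChart = {z : ℝ × ℝ | z.1 = 0 ∨ z.1 = 1}ᶜ ∪ {z | z.2 < 0} := by
    ext z; simp only [lowerChart, mem_ofPred_eq, mem_union, mem_compl_iff]; tauto
  rw [this]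
  exact isClosed_walls.isOpen_compl.union (isOpen_lt continuous_snd continuous_const)

lemma mem_upperChart_or_lowerChart {z : ℝ × ℝ} (hz : z ∈ puncturedPlane) :
    z ∈ upperChart ∨ z ∈ lowerChart := by
  by_cases h : z.1 = 0 ∨ z.1 = 1
  · rcases lt_or_gt_of_ne (hz h) with h' | h'
    · exact .inr fun _ => h'
    · exact .inl fun _ => h'
  · exact .inl fun h' => absurd h' h

lemma not_wall {z : ℝ × ℝ} (h₁ : z ∈ upperChart) (h₂ : z ∈ lowerChart) :
    ¬(z.1 = 0 ∨ z.1 = 1) := fun h => lt_asymm (h₁ h) (h₂ h)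

lemma mem_stripBase_iff {x : ℝ} {s : Fin 3} :
    x ∈ stripBase s ↔ ¬(x = 0 ∨ x = 1) ∧ stripIndex x = s := by
  unfold stripIndex
  fin_cases s <;> simp only [stripBase] <;> split_ifs <;> simp <;> grind

lemma isOpen_stripBase (s : Fin 3) : IsOpen (stripBase s) := by
  fin_cases s
  exacts [isOpen_Iio, isOpen_Ioo, isOpen_Ioi]

lemma convex_stripBase (s : Fin 3) : Convex ℝ (stripBase s) := by
  fin_cases s
  exacts [convex_Iio 0, convex_Ioo 0 1, convex_Ioi 1]

lemma mem_charts_of_mem_stripBase {z : ℝ × ℝ} {s : Fin 3} (h : z.1 ∈ stripBase s) :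
    z ∈ upperChart ∧ z ∈ lowerChart :=
  ⟨fun h' => absurd h' (mem_stripBase_iff.1 h).1, fun h' => absurd h' (mem_stripBase_iff.1 h).1⟩

/-- A family of continuous maps pushing the line into the strip base `stripBase s`. -/
lemma exists_stripBase_retraction (s : Fin 3) : ∃ p : ℝ × ℝ → ℝ, Continuous p ∧
    (∀ x ∈ stripBase s, p (0, x) = x) ∧
    (∀ ε x, 0 < ε → ε ≤ 1 → p (ε, x) ∈ stripBase s) ∧
    (∀ x, p (0, x) = x → x ∉ stripBase s → x = 0 ∨ x = 1) := by
  fin_cases s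
  · refine ⟨fun q => min q.2 0 - q.1, by fun_prop, ?_, ?_, ?_⟩ <;>
      simp only [stripBase] <;> simp <;> grind
  · refine ⟨fun q => max 0 (min q.2 1) + q.1 * (1 / 2 - max 0 (min q.2 1)), by fun_prop,
      ?_, ?_, ?_⟩
    · simp only [stripBase]; simp; grind
    · intro ε x h0 h1
      have h2 : 0 ≤ max 0 (min x 1) := le_max_left _ _
      have h3 : max 0 (min x 1) ≤ 1 := max_le zero_le_one (min_le_right _ _)
      change max 0 (min x 1) + ε * (1 / 2 - max 0 (min x 1)) ∈ Ioo (0 : ℝ) 1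
      generalize max 0 (min x 1) = m at *
      constructor <;> nlinarith
    · simp only [stripBase]; simp; grind
  · refine ⟨fun q => max q.2 1 + q.1, by fun_prop, ?_, ?_, ?_⟩ <;>
      simp only [stripBase] <;> simp <;> grind

lemma eventually_mem_stripBase_iff (s : Fin 3) {x : ℝ} (hx : ¬(x = 0 ∨ x = 1)) :
    ∀ᶠ y in 𝓝 x, y ∈ stripBase s ↔ x ∈ stripBase s := by
  have h : x ∈ stripBase (stripIndex x) := mem_stripBase_iff.2 ⟨hx, rfl⟩
  filter_upwards [(isOpen_stripBase _).mem_nhds h] with y hy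
  rw [mem_stripBase_iff] at hy ⊢
  rw [mem_stripBase_iff, hy.2]
  tauto

open Classical in
/-- The amount by which points of `upperChart` outside of the strip `s` are lifted. -/
lemma continuousOn_lift_height (s : Fin 3) :
    ContinuousOn (fun z : ℝ × ℝ => if z.1 ∈ stripBase s then 0 else |z.2| - z.2) upperChart := by
  intro z hz
  refine ContinuousAt.continuousWithinAt ?_
  by_cases h : z.1 = 0 ∨ z.1 = 1
  · refine (continuousAt_const (y := (0 : ℝ))).congr ?_
    filter_upwards [(isOpen_lt continuous_const continuous_snd).mem_nhds (hz h)] with y hy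
    have : |y.2| = y.2 := abs_of_pos hy
    simp [this]
  · have := (continuous_fst (X := ℝ) (Y := ℝ)).continuousAt.eventually
      (eventually_mem_stripBase_iff s h)
    by_cases hs : z.1 ∈ stripBase s
    · refine (continuousAt_const (y := (0 : ℝ))).congr ?_
      filter_upwards [this] with y hy
      simp [hy, hs]
    · refine (show ContinuousAt (fun z : ℝ × ℝ => |z.2| - z.2) z by fun_prop).congr ?_
      filter_upwards [this] with y hy
      simp [hy, hs]

/-- A deformation of `upperChart` inside the punctured plane, fixing the lower half of the
strip `s` and ending in this strip. -/
lemma exists_push_upperChart (s : Fin 3) : ∃ h : ℝ × (ℝ × ℝ) → ℝ × ℝ,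
    ContinuousOn h (univ ×ˢ upperChart) ∧ (∀ z, h (0, z) = z) ∧
    (∀ t ∈ Icc (0 : ℝ) 1, ∀ z ∈ upperChart, h (t, z) ∈ puncturedPlane) ∧
    (∀ z ∈ upperChart, (h (1, z)).1 ∈ stripBase s) ∧
    (∀ t z, z.1 ∈ stripBase s → z.2 ≤ 0 → h (t, z) = z) := by
  classical
  obtain ⟨p, hp, hp0, hp1, hp2⟩ := exists_stripBase_retraction s
  let κ : ℝ × ℝ → ℝ := fun z =>
    |z.1 - p (0, z.1)| + if z.1 ∈ stripBase s then 0 else |z.2| - z.2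
  have hκ : ContinuousOn κ upperChart :=
    (by fun_prop : Continuous fun z : ℝ × ℝ => |z.1 - p (0, z.1)|).continuousOn.add
      (continuousOn_lift_height s)
  have hκ0 : ∀ z, 0 ≤ κ z := fun z => by
    have := le_abs_self z.2
    simp only [κ]
    split_ifs <;> [positivity; exact add_nonneg (abs_nonneg _) (by linarith)]
  have hκs : ∀ z : ℝ × ℝ, z.1 ∈ stripBase s → κ z = 0 := fun z hz => by simp [κ, hz, hp0]
  have hκ1 : ∀ z ∈ upperChart, z.1 ∉ stripBase s → 0 < z.2 + κ z := fun z hz hs => by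
    have h1 := abs_nonneg (z.1 - p (0, z.1))
    simp only [κ, hs, if_false]
    by_cases h : p (0, z.1) = z.1
    · have := hz (hp2 _ h hs)
      have := abs_nonneg z.2
      have := abs_pos_of_pos (hz (hp2 _ h hs))
      linarith
    · have := abs_pos.2 (sub_ne_zero.2 (Ne.symm h))
      have := abs_nonneg z.2
      linarith
  let A : ℝ × (ℝ × ℝ) → ℝ × ℝ := fun q => (q.2.1, q.2.2 + min (2 * q.1) 1 * κ q.2)
  let B : ℝ × (ℝ × ℝ) → ℝ × ℝ := fun q =>
    (q.2.1 + max (2 * q.1 - 1) 0 * (p (min (max q.2.2 0) 1, q.2.1) - q.2.1), q.2.2)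
  have hB : Continuous B := by fun_prop
  have hA : ContinuousOn A (univ ×ˢ upperChart) := by
    have : ContinuousOn (fun q : ℝ × (ℝ × ℝ) => κ q.2) (univ ×ˢ upperChart) :=
      hκ.comp continuousOn_snd fun q hq => hq.2
    exact (by fun_prop : Continuous fun q : ℝ × (ℝ × ℝ) => q.2.1).continuousOn.prodMk
      ((by fun_prop : Continuous fun q : ℝ × (ℝ × ℝ) => q.2.2).continuousOn.add
        ((by fun_prop : Continuous fun q : ℝ × (ℝ × ℝ) => min (2 * q.1) 1).continuousOn.mul this))
  have hBs : ∀ (t : ℝ) (z : ℝ × ℝ), z.1 ∈ stripBase s → z.2 ≤ 0 → B (t, z) = z := by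
    intro t z hz h
    simp [B, h, hp0 _ hz]
  refine ⟨fun q => B (q.1, A q), hB.comp_continuousOn (continuousOn_fst.prodMk hA), ?_, ?_, ?_, ?_⟩
  · intro z
    simp [A, B]
  · intro t ht z hz
    rcases le_total t (1 / 2) with h | h
    · have : max (2 * t - 1) 0 = 0 := max_eq_right (by linarith)
      simp only [A, B, this, zero_mul, add_zero]
      intro hw
      have h1 : 0 ≤ min (2 * t) 1 := le_min (by linarith [ht.1]) zero_le_one
      exact (add_pos_of_pos_of_nonneg (hz hw) (mul_nonneg h1 (hκ0 z))).ne'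
    · have h1 : min (2 * t) 1 = 1 := min_eq_right (by linarith)
      by_cases hy : z.2 + κ z ≤ 0
      · have hs : z.1 ∈ stripBase s := by
          by_contra hs; exact (hκ1 z hz hs).not_ge hy
        have : B (t, A (t, z)) = A (t, z) := hBs t _ hs (by simpa [A, h1] using hy)
        dsimp only
        rw [this]
        exact upperChart_subset (mem_charts_of_mem_stripBase (z := A (t, z)) (s := s) hs).1
      · intro _
        simp only [A, B, h1, one_mul]
        exact (not_le.1 hy).ne'
  · intro z hz
    by_cases hy : z.2 + κ z ≤ 0
    · have hs : z.1 ∈ stripBase s := by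
        by_contra hs; exact (hκ1 z hz hs).not_ge hy
      have : B (1, A (1, z)) = A (1, z) :=
        hBs 1 _ hs (by simpa [A, show min (2 : ℝ) 1 = 1 by norm_num] using hy)
      dsimp only
      rw [this]
      exact hs
    · have := hp1 (min (max (z.2 + κ z) 0) 1) z.1
        (lt_min (lt_max_of_lt_left (not_le.1 hy)) one_pos) (min_le_right _ _)
      simpa [A, B, show min (2 : ℝ) 1 = 1 by norm_num,
        show (2 : ℝ) - 1 = 1 by norm_num] using this
  · intro t z hz h
    have : A (t, z) = z := by simp [A, hκs z hz]
    dsimp only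
    rw [this, hBs t z hz h]

/-- A labelling of a map to the punctured plane by a group: this is the same thing as a lift
to the principal bundle with cocycle `c` on the three strips. -/
structure IsLabelling {K G : Type*} [TopologicalSpace K] [Group G] (c : Fin 3 → G)
    (φ : K → puncturedPlane) (w₁ w₂ : K → G) : Prop where
  upper : ∀ x, (φ x : ℝ × ℝ) ∈ upperChart → ∀ᶠ y in 𝓝 x, w₁ y = w₁ x
  lower : ∀ x, (φ x : ℝ × ℝ) ∈ lowerChart → ∀ᶠ y in 𝓝 x, w₂ y = w₂ x
  compat : ∀ x, (φ x : ℝ × ℝ) ∈ upperChart → (φ x : ℝ × ℝ) ∈ lowerChart →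
    w₂ x = c (stripIndex (φ x : ℝ × ℝ).1) * w₁ x

/-- A sheet over `upperChart` which has only one neighbouring sheet that the map really needs
can be removed by a homotopy. -/
lemma IsLabelling.exists_remove_sheet {K G : Type*} [TopologicalSpace K] [Group G]
    {c : Fin 3 → G} {φ : C(K, puncturedPlane)} {w₁ w₂ : K → G} (hw : IsLabelling c φ w₁ w₂)
    (g : G) (s : Fin 3)
    (hs : ∀ r ≠ s, ∀ x, (φ x : ℝ × ℝ) ∉ upperChart → w₂ x ≠ c r * g) :
    ∃ (φ' : C(K, puncturedPlane)) (w₂' : K → G), φ.Homotopic φ' ∧ IsLabelling c φ' w₁ w₂' ∧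
      (∀ x, (φ' x : ℝ × ℝ) ∉ upperChart → (φ x : ℝ × ℝ) ∉ upperChart ∧ w₂' x = w₂ x) ∧
      (∀ x, (φ' x : ℝ × ℝ) ∉ lowerChart → (φ x : ℝ × ℝ) ∉ lowerChart ∧ w₁ x ≠ g) := by
  classical
  obtain ⟨h, hcont, h0, hmem, h1, hfix⟩ := exists_push_upperChart s
  let φr : K → ℝ × ℝ := fun x => φ x
  have hφ : Continuous φr := continuous_subtype_val.comp φ.continuous
  let S : Set K := {x | φr x ∈ upperChart ∧ w₁ x = g}
  have hSnear : ∀ x ∈ S, ∀ᶠ y in 𝓝 x, y ∈ S := by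
    intro x hx
    filter_upwards [hw.upper x hx.1, (isOpen_upperChart.preimage hφ).mem_nhds hx.1] with y hy hy'
    exact ⟨hy', hy.trans hx.2⟩
  have hSfar : ∀ x ∉ S, ∀ᶠ y in 𝓝 x, y ∈ S → (φr y).1 ∈ stripBase s ∧ (φr y).2 ≤ 0 := by
    intro x hx
    by_cases hU : φr x ∈ upperChart
    · filter_upwards [hw.upper x hU] with y hy hyS
      exact absurd ⟨hU, hy.symm.trans hyS.2⟩ hx
    · have hL : φr x ∈ lowerChart := (mem_upperChart_or_lowerChart (φ x).2).resolve_left hU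
      have hneg : (φr x).2 < 0 := by
        simp only [upperChart, mem_ofPred_eq, Classical.not_imp] at hU
        exact hL hU.1
      filter_upwards [hw.lower x hL, (isOpen_lowerChart.preimage hφ).mem_nhds hL,
        (isOpen_lt (continuous_snd.comp hφ) continuous_const).mem_nhds hneg] with y hy hyL hyn hyS
      refine ⟨mem_stripBase_iff.2 ⟨not_wall hyS.1 hyL, ?_⟩, le_of_lt hyn⟩
      by_contra hne
      refine hs _ hne x hU ?_
      rw [← hy, ← hyS.2]
      exact hw.compat y hyS.1 hyL
  let H : I × K → ℝ × ℝ := fun q => if q.2 ∈ S then h (q.1, φr q.2) else φr q.2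
  have hHcont : Continuous H := by
    refine continuous_iff_continuousAt.2 fun q => ?_
    by_cases hq : q.2 ∈ S
    · have hc : ContinuousAt (fun q : I × K => h (q.1, φr q.2)) q := by
        have hn : (univ ×ˢ upperChart) ∈ 𝓝 ((q.1 : ℝ), φr q.2) :=
          (isOpen_univ.prod isOpen_upperChart).mem_nhds ⟨mem_univ _, hq.1⟩
        exact ContinuousAt.comp (f := fun q : I × K => ((q.1 : ℝ), φr q.2)) (g := h)
          (hcont.continuousAt hn) (by fun_prop)
      refine hc.congr ?_
      filter_upwards [continuous_snd.continuousAt.eventually (hSnear _ hq)] with y hy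
      simp [H, hy]
    · have hc : ContinuousAt (fun q : I × K => φr q.2) q := by fun_prop
      refine hc.congr ?_
      filter_upwards [continuous_snd.continuousAt.eventually (hSfar _ hq)] with y hy
      by_cases hyS : y.2 ∈ S
      · simp only [H, hyS, if_true]
        exact (hfix _ _ (hy hyS).1 (hy hyS).2).symm
      · simp [H, hyS]
  have hHmem : ∀ q, H q ∈ puncturedPlane := by
    intro q
    by_cases hq : q.2 ∈ S
    · simp only [H, hq, if_true]
      exact hmem _ q.1.2 _ hq.1
    · simp only [H, hq, if_false]
      exact (φ q.2).2
  let φ' : C(K, puncturedPlane) := ⟨fun x => ⟨H (1, x), hHmem _⟩, by fun_prop⟩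
  have hφ'S : ∀ x ∈ S, (φ' x : ℝ × ℝ).1 ∈ stripBase s := by
    intro x hx
    simp only [φ', H, ContinuousMap.coe_mk, hx, if_true]
    exact h1 _ hx.1
  have hφ'nS : ∀ x ∉ S, φ' x = φ x := by
    intro x hx
    apply Subtype.ext
    simp [φ', H, hx, φr]
  refine ⟨φ', fun x => if x ∈ S then c s * g else w₂ x, ⟨?_⟩, ⟨?_, ?_, ?_⟩, ?_, ?_⟩
  · exact
      { toFun := fun q => ⟨H q, hHmem q⟩
        continuous_toFun := by fun_prop
        map_zero_left := fun x => by
          apply Subtype.ext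
          by_cases hx : x ∈ S <;> simp [H, hx, h0, φr]
        map_one_left := fun x => rfl }
  · intro x hx
    by_cases hxS : x ∈ S
    · exact hw.upper x hxS.1
    · exact hw.upper x (hφ'nS x hxS ▸ hx)
  · intro x hx
    by_cases hxS : x ∈ S
    · filter_upwards [hSnear x hxS] with y hy
      simp [hy, hxS]
    · have hL : φr x ∈ lowerChart := by rw [hφ'nS x hxS] at hx; exact hx
      filter_upwards [hw.lower x hL, hSfar x hxS] with y hy hyS
      by_cases hyS' : y ∈ S
      · have := hw.compat y hyS'.1 (mem_charts_of_mem_stripBase (hyS hyS').1).2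
        rw [(mem_stripBase_iff.1 (hyS hyS').1).2, hyS'.2, hy] at this
        simp [hxS, hyS', this]
      · simp [hxS, hyS', hy]
  · intro x hx hx'
    by_cases hxS : x ∈ S
    · simp only [hxS, if_true]
      rw [(mem_stripBase_iff.1 (hφ'S x hxS)).2, hxS.2]
    · rw [hφ'nS x hxS] at hx hx' ⊢
      simpa [hxS] using hw.compat x hx hx'
  · intro x hx
    have hxS : x ∉ S := fun hxS => hx (mem_charts_of_mem_stripBase (hφ'S x hxS)).1
    rw [hφ'nS x hxS] at hx
    exact ⟨hx, by simp [hxS]⟩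
  · intro x hx
    have hxS : x ∉ S := fun hxS => hx (mem_charts_of_mem_stripBase (hφ'S x hxS)).2
    rw [hφ'nS x hxS] at hx
    exact ⟨hx, fun hg =>
      hxS ⟨(mem_upperChart_or_lowerChart (φ x).2).resolve_right hx, hg⟩⟩

/-- The reflection of the punctured plane in the first axis. -/
def mirror : C(puncturedPlane, puncturedPlane) where
  toFun z := ⟨(z.1.1, -z.1.2), fun h => neg_ne_zero.2 (z.2 h)⟩
  continuous_toFun := by fun_prop

lemma mirror_mem_upperChart {z : puncturedPlane} :
    (mirror z : ℝ × ℝ) ∈ upperChart ↔ (z : ℝ × ℝ) ∈ lowerChart := by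
  simp [mirror, upperChart, lowerChart]

lemma mirror_mem_lowerChart {z : puncturedPlane} :
    (mirror z : ℝ × ℝ) ∈ lowerChart ↔ (z : ℝ × ℝ) ∈ upperChart := by
  simp [mirror, upperChart, lowerChart]

lemma mirror_comp_mirror : mirror.comp mirror = ContinuousMap.id _ := by
  ext z <;> simp [mirror]

lemma IsLabelling.mirror {K G : Type*} [TopologicalSpace K] [Group G] {c : Fin 3 → G}
    {φ : C(K, puncturedPlane)} {w₁ w₂ : K → G} (hw : IsLabelling c φ w₁ w₂) :
    IsLabelling c⁻¹ (mirror.comp φ) w₂ w₁ where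
  upper x hx := hw.lower x (mirror_mem_upperChart.1 hx)
  lower x hx := hw.upper x (mirror_mem_lowerChart.1 hx)
  compat x hx hx' := by
    rw [hw.compat x (mirror_mem_lowerChart.1 hx') (mirror_mem_upperChart.1 hx)]
    simp [_root_.mirror]

lemma nullhomotopic_of_mirror {K : Type*} [TopologicalSpace K] {φ : C(K, puncturedPlane)}
    (h : (mirror.comp φ).Nullhomotopic) : φ.Nullhomotopic := by
  have := h.comp_right mirror
  rwa [← ContinuousMap.comp_assoc, mirror_comp_mirror, ContinuousMap.id_comp] at this

lemma IsCompact.finite_image_of_eventually_eq {K G : Type*} [TopologicalSpace K] {A : Set K}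
    (hA : IsCompact A) {w : K → G} (hw : ∀ x ∈ A, ∀ᶠ y in 𝓝 x, w y = w x) :
    (w '' A).Finite := by
  obtain ⟨t, -, ht⟩ := hA.elim_nhds_subcover (fun x => {y | w y = w x}) hw
  refine (t.finite_toSet.image w).subset ?_
  rintro _ ⟨x, hx, rfl⟩
  obtain ⟨y, hy, hxy⟩ := mem_iUnion₂.1 (ht hx)
  exact ⟨y, hy, Eq.symm hxy⟩

lemma IsLabelling.finite_upper {K G : Type*} [TopologicalSpace K] [CompactSpace K] [Group G]
    {c : Fin 3 → G} {φ : C(K, puncturedPlane)} {w₁ w₂ : K → G} (hw : IsLabelling c φ w₁ w₂) :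
    (w₁ '' {x | (φ x : ℝ × ℝ) ∉ lowerChart}).Finite := by
  refine IsCompact.finite_image_of_eventually_eq (IsClosed.isCompact ?_) fun x hx =>
    hw.upper x ((mem_upperChart_or_lowerChart (φ x).2).resolve_right hx)
  exact (isOpen_lowerChart.preimage (continuous_subtype_val.comp φ.continuous)).isClosed_compl

lemma IsLabelling.finite_lower {K G : Type*} [TopologicalSpace K] [CompactSpace K] [Group G]
    {c : Fin 3 → G} {φ : C(K, puncturedPlane)} {w₁ w₂ : K → G} (hw : IsLabelling c φ w₁ w₂) :
    (w₂ '' {x | (φ x : ℝ × ℝ) ∉ upperChart}).Finite := by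
  simpa [mirror_mem_lowerChart] using hw.mirror.finite_upper

/-- A map from a connected space avoiding the vertical lines through the punctures is
nullhomotopic. -/
lemma nullhomotopic_of_mem_charts {K : Type*} [TopologicalSpace K] [ConnectedSpace K]
    (φ : C(K, puncturedPlane))
    (h : ∀ x, (φ x : ℝ × ℝ) ∈ upperChart ∧ (φ x : ℝ × ℝ) ∈ lowerChart) :
    φ.Nullhomotopic := by
  obtain ⟨x₀⟩ : Nonempty K := inferInstance
  have hφ : Continuous fun x => (φ x : ℝ × ℝ) := continuous_subtype_val.comp φ.continuous
  let s := stripIndex (φ x₀ : ℝ × ℝ).1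
  have hs : ∀ x, (φ x : ℝ × ℝ).1 ∈ stripBase s := by
    have hloc : IsLocallyConstant fun x => stripIndex (φ x : ℝ × ℝ).1 := by
      rw [IsLocallyConstant.iff_eventually_eq]
      intro x
      have hx : (φ x : ℝ × ℝ).1 ∈ stripBase (stripIndex (φ x : ℝ × ℝ).1) :=
        mem_stripBase_iff.2 ⟨not_wall (h x).1 (h x).2, rfl⟩
      filter_upwards [((isOpen_stripBase _).preimage (continuous_fst.comp hφ)).mem_nhds hx]
        with y hy
      exact (mem_stripBase_iff.1 hy).2
    exact fun x => mem_stripBase_iff.2 ⟨not_wall (h x).1 (h x).2,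
      hloc.apply_eq_of_preconnectedSpace x x₀⟩
  let H : I × K → ℝ × ℝ := fun q => (1 - (q.1 : ℝ)) • (φ q.2 : ℝ × ℝ) + (q.1 : ℝ) • (φ x₀ : ℝ × ℝ)
  have hH : ∀ q, H q ∈ puncturedPlane := fun q => by
    have : (H q).1 ∈ stripBase s := convex_stripBase s (hs q.2) (hs x₀)
      (sub_nonneg.2 q.1.2.2) q.1.2.1 (sub_add_cancel _ _)
    exact upperChart_subset (mem_charts_of_mem_stripBase this).1
  exact ⟨φ x₀, ⟨
    { toFun := fun q => ⟨H q, hH q⟩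
      continuous_toFun := by fun_prop
      map_zero_left := fun x => by simp [H]
      map_one_left := fun x => by simp [H] }⟩⟩

/-- A labelled map from a compact connected space is nullhomotopic, if the group carries a length
function which only decreases in one direction. -/
theorem IsLabelling.nullhomotopic {K G : Type*} [TopologicalSpace K] [CompactSpace K]
    [ConnectedSpace K] [Group G] (ℓ : G → ℕ) {c : Fin 3 → G}
    (hc : ∀ g, ∃ s, ∀ r ≠ s, ℓ g < ℓ (c r * g))
    (hc' : ∀ g, ∃ s, ∀ r ≠ s, ℓ g < ℓ (c⁻¹ r * g))
    {φ : C(K, puncturedPlane)} {w₁ w₂ : K → G} (hw : IsLabelling c φ w₁ w₂) :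
    φ.Nullhomotopic := by
  obtain ⟨n, hn⟩ : ∃ n, (w₁ '' {x | (φ x : ℝ × ℝ) ∉ lowerChart}).ncard +
    (w₂ '' {x | (φ x : ℝ × ℝ) ∉ upperChart}).ncard = n := ⟨_, rfl⟩
  induction n using Nat.strong_induction_on generalizing c φ w₁ w₂ with
  | _ n ih =>
  have key : ∀ {c : Fin 3 → G} {φ : C(K, puncturedPlane)} {w₁ w₂ : K → G}
      (hc : ∀ g, ∃ s, ∀ r ≠ s, ℓ g < ℓ (c r * g))
      (hc' : ∀ g, ∃ s, ∀ r ≠ s, ℓ g < ℓ (c⁻¹ r * g))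
      (hw : IsLabelling c φ w₁ w₂)
      (hn : (w₁ '' {x | (φ x : ℝ × ℝ) ∉ lowerChart}).ncard +
        (w₂ '' {x | (φ x : ℝ × ℝ) ∉ upperChart}).ncard = n)
      (g : G) (hg : g ∈ w₁ '' {x | (φ x : ℝ × ℝ) ∉ lowerChart})
      (hmax : ∀ x, (φ x : ℝ × ℝ) ∉ upperChart → ℓ (w₂ x) ≤ ℓ g), φ.Nullhomotopic := by
    intro c φ w₁ w₂ hc hc' hw hn g hg hmax
    obtain ⟨s, hs⟩ := hc g
    obtain ⟨φ', w₂', hφ, hw', h₂, h₁⟩ := hw.exists_remove_sheet g s fun r hr x hx heq =>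
      (hs r hr).not_ge (heq ▸ hmax x hx)
    suffices hlt : (w₁ '' {x | (φ' x : ℝ × ℝ) ∉ lowerChart}).ncard +
        (w₂' '' {x | (φ' x : ℝ × ℝ) ∉ upperChart}).ncard < n by
      obtain ⟨y, hy⟩ := ih _ hlt hc hc' hw' rfl
      exact ⟨y, hφ.trans hy⟩
    rw [← hn]
    refine add_lt_add_of_lt_of_le ?_ ?_
    · refine ncard_lt_ncard ?_ hw.finite_upper
      refine ⟨image_mono fun x hx => (h₁ x hx).1, fun hsub => ?_⟩
      obtain ⟨x, hx, hxg⟩ := hsub hg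
      exact (h₁ x hx).2 hxg
    · refine ncard_le_ncard ?_ hw.finite_lower
      rintro _ ⟨x, hx, rfl⟩
      exact ⟨x, (h₂ x hx).1, (h₂ x hx).2.symm⟩
  by_cases hne : (w₁ '' {x | (φ x : ℝ × ℝ) ∉ lowerChart} ∪
      w₂ '' {x | (φ x : ℝ × ℝ) ∉ upperChart}).Nonempty
  · obtain ⟨g, hg, hmax⟩ := exists_max_image _ ℓ (hw.finite_upper.union hw.finite_lower) hne
    rcases hg with hg | hg
    · exact key hc hc' hw hn g hg fun x hx => hmax _ (.inr ⟨x, hx, rfl⟩)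
    · refine nullhomotopic_of_mirror (key hc' (by simpa using hc) hw.mirror ?_ g ?_ ?_)
      · simpa [mirror_mem_lowerChart, mirror_mem_upperChart, add_comm] using hn
      · simpa [mirror_mem_lowerChart] using hg
      · intro x hx
        exact hmax _ (.inl ⟨x, fun h => hx (mirror_mem_upperChart.2 h), rfl⟩)
  · rw [not_nonempty_iff_eq_empty, union_empty_iff, image_eq_empty, image_eq_empty] at hne
    refine nullhomotopic_of_mem_charts φ fun x => ⟨?_, ?_⟩
    · by_contra h
      exact (hne.2 ▸ (show x ∈ {x | (φ x : ℝ × ℝ) ∉ upperChart} from h) : x ∈ (∅ : Set K))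
    · by_contra h
      exact (hne.1 ▸ (show x ∈ {x | (φ x : ℝ × ℝ) ∉ lowerChart} from h) : x ∈ (∅ : Set K))

lemma FreeGroup.exists_forall_norm_lt {α : Type*} [DecidableEq α] [Nonempty α] (b : Bool)
    (g : FreeGroup α) :
    ∃ s, ∀ r ≠ s, g.norm < (FreeGroup.mk [(r, b)] * g).norm := by
  have h : ∀ r, (∀ l, g.toWord ≠ (r, !b) :: l) →
      g.norm < (FreeGroup.mk [(r, b)] * g).norm := by
    intro r hr
    have : (FreeGroup.mk [(r, b)] * g).toWord = (r, b) :: g.toWord := by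
      conv_lhs => rw [← g.mk_toWord, FreeGroup.mul_mk, FreeGroup.toWord_mk]
      rw [List.singleton_append, FreeGroup.reduce.cons, FreeGroup.reduce_toWord]
      rcases hg : g.toWord with _ | ⟨⟨a, b'⟩, l⟩
      · rfl
      · have : ¬(r = a ∧ b = !b') := by
          rintro ⟨rfl, rfl⟩
          exact hr l (by simp [hg])
        simp [this]
    simp [FreeGroup.norm, this]
  rcases hg : g.toWord with _ | ⟨⟨a, b'⟩, l⟩
  · exact ⟨Classical.arbitrary α, fun r _ => h r (by simp [hg])⟩
  · refine ⟨a, fun r hr => h r fun l' => ?_⟩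
    rw [hg]
    intro h'
    simp only [List.cons.injEq, Prod.mk.injEq] at h'
    exact hr h'.1.1.symm

/-- A map from a compact connected space which is labelled by a free group is nullhomotopic. -/
theorem IsLabelling.nullhomotopic_of_freeGroup {K : Type*} [TopologicalSpace K] [CompactSpace K]
    [ConnectedSpace K] {φ : C(K, puncturedPlane)} {w₁ w₂ : K → FreeGroup (Fin 3)}
    (hw : IsLabelling FreeGroup.of φ w₁ w₂) : φ.Nullhomotopic :=
  hw.nullhomotopic FreeGroup.norm (FreeGroup.exists_forall_norm_lt true)
    (FreeGroup.exists_forall_norm_lt false)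

section Covering

variable {G : Type*} [Group G]

/-- The value of the cocycle on the overlap of two charts; `true` stands for `upperChart`. -/
noncomputable def chartCocycle (c : Fin 3 → G) (x : ℝ) : Bool → Bool → G
  | true, false => c (stripIndex x)
  | false, true => (c (stripIndex x))⁻¹
  | _, _ => 1

/-- The two charts, as subsets of the punctured plane. -/
def chart (i : Bool) : Set puncturedPlane :=
  {z | (z : ℝ × ℝ) ∈ if i then upperChart else lowerChart}

lemma isOpen_chart (i : Bool) : IsOpen (chart i) := by
  cases i
  exacts [isOpen_lowerChart.preimage continuous_subtype_val,
    isOpen_upperChart.preimage continuous_subtype_val]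

lemma eventually_chartCocycle_eq (c : Fin 3 → G) (i j : Bool) {z : puncturedPlane}
    (hi : z ∈ chart i) (hj : z ∈ chart j) :
    ∀ᶠ y : puncturedPlane in 𝓝 z,
      chartCocycle c (y : ℝ × ℝ).1 i j = chartCocycle c (z : ℝ × ℝ).1 i j := by
  have main (h : ¬((z : ℝ × ℝ).1 = 0 ∨ (z : ℝ × ℝ).1 = 1)) :
      ∀ᶠ y : puncturedPlane in 𝓝 z, stripIndex (y : ℝ × ℝ).1 = stripIndex (z : ℝ × ℝ).1 := by
    have hz : (z : ℝ × ℝ).1 ∈ stripBase (stripIndex (z : ℝ × ℝ).1) := mem_stripBase_iff.2 ⟨h, rfl⟩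
    filter_upwards [((isOpen_stripBase _).preimage
      (continuous_fst.comp continuous_subtype_val)).mem_nhds hz] with y hy
    exact (mem_stripBase_iff.1 hy).2
  cases i <;> cases j
  · exact .of_forall fun _ => rfl
  · filter_upwards [main (not_wall hj hi)] with y hy
    simp [chartCocycle, hy]
  · filter_upwards [main (not_wall hi hj)] with y hy
    simp [chartCocycle, hy]
  · exact .of_forall fun _ => rfl

variable [TopologicalSpace G] [DiscreteTopology G]

open Classical in
/-- The principal bundle over the punctured plane with cocycle `c`. -/
noncomputable def labelBundle (c : Fin 3 → G) : FiberBundleCore Bool puncturedPlane G where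
  baseSet := chart
  isOpen_baseSet := isOpen_chart
  indexAt z := decide ((z : ℝ × ℝ) ∈ upperChart)
  mem_baseSet_at z := by
    by_cases h : (z : ℝ × ℝ) ∈ upperChart
    · simp [chart, h]
    · simpa [chart, h] using (mem_upperChart_or_lowerChart z.2).resolve_left h
  coordChange i j z v := chartCocycle c (z : ℝ × ℝ).1 i j * v
  coordChange_self i z _ v := by cases i <;> simp [chartCocycle]
  continuousOn_coordChange i j := by
    rintro ⟨z, v⟩ ⟨⟨hi, hj⟩, -⟩
    refine ContinuousAt.continuousWithinAt ?_
    have : ContinuousAt (fun p : puncturedPlane × G => chartCocycle c (z : ℝ × ℝ).1 i j * p.2)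
        (z, v) := (continuous_of_discreteTopology.comp continuous_snd).continuousAt
    refine this.congr ?_
    filter_upwards [(continuous_fst (X := puncturedPlane) (Y := G)).continuousAt.eventually
      (eventually_chartCocycle_eq c i j hi hj)] with y hy
    rw [hy]
  coordChange_comp i j k z _ v := by
    cases i <;> cases j <;> cases k <;> simp [chartCocycle]

lemma exists_isLabelling_of_discreteTopology {K : Type*} [TopologicalSpace K]
    [SimplyConnectedSpace K] [LocallyPathConnectedSpace K] (c : Fin 3 → G)
    (φ : C(K, puncturedPlane)) : ∃ w₁ w₂ : K → G, IsLabelling c φ w₁ w₂ := by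
  let Z := labelBundle c
  have hcov : IsCoveringMap (Bundle.TotalSpace.proj : Bundle.TotalSpace G Z.Fiber → _) :=
    FiberBundle.isCoveringMap
  obtain ⟨x₀⟩ : Nonempty K := inferInstance
  obtain ⟨Φ, ⟨-, hΦ⟩, -⟩ := hcov.existsUnique_continuousMap_lifts φ x₀ ⟨φ x₀, (1 : G)⟩ rfl
  have hΦ' : ∀ x, (Φ x).proj = φ x := fun x => congrFun hΦ x
  let w : Bool → K → G := fun i x => (Z.localTriv i (Φ x)).2
  have hw : ∀ i x, φ x ∈ chart i → ∀ᶠ y in 𝓝 x, w i y = w i x := by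
    intro i x hx
    have hsrc : Φ x ∈ (Z.localTriv i).source := by
      rw [Z.mem_localTriv_source, hΦ' x]
      exact hx
    have hc : ContinuousAt (w i) x :=
      continuous_snd.continuousAt.comp
        (((Z.localTriv i).continuousAt hsrc).comp Φ.continuous.continuousAt)
    exact hc.eventually (by simp : ∀ᶠ v in 𝓝 (w i x), v = w i x)
  refine ⟨w true, w false, fun x hx => hw true x hx, fun x hx => hw false x hx,
    fun x hx hx' => ?_⟩
  have := Z.coordChange_comp (Z.indexAt (φ x)) true false (φ x)
    ⟨⟨Z.mem_baseSet_at _, hx⟩, hx'⟩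
  have h2 := this (Φ x).2
  simp only [w, FiberBundleCore.localTriv_apply]
  rw [hΦ' x]
  exact h2.symm

end Covering

/-- Maps from simply connected spaces can be labelled. -/
lemma exists_isLabelling {K G : Type*} [TopologicalSpace K] [SimplyConnectedSpace K]
    [LocallyPathConnectedSpace K] [Group G] (c : Fin 3 → G) (φ : C(K, puncturedPlane)) :
    ∃ w₁ w₂ : K → G, IsLabelling c φ w₁ w₂ := by
  let _ : TopologicalSpace G := ⊥
  have : DiscreteTopology G := ⟨rfl⟩
  exact exists_isLabelling_of_discreteTopology c φ

local notation "E³" => EuclideanSpace ℝ (Fin 3)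

lemma IsLabelling.antipodal_eq {φ : C(E³, puncturedPlane)} {w₁ w₂ : E³ → FreeGroup (Fin 3)}
    (hw : IsLabelling FreeGroup.of φ w₁ w₂) (hφ : ∀ v, ‖v‖ = 1 → φ (-v) = φ v) {v : E³}
    (hv : ‖v‖ = 1) :
    ((φ v : ℝ × ℝ) ∈ upperChart → w₁ (-v) = w₁ v) ∧
      ((φ v : ℝ × ℝ) ∈ lowerChart → w₂ (-v) = w₂ v) := by
  classical
  let D : Metric.sphere (0 : E³) 1 → FreeGroup (Fin 3) := fun v =>
    if (φ v : ℝ × ℝ) ∈ upperChart then (w₁ v)⁻¹ * w₁ (-v) else (w₂ v)⁻¹ * w₂ (-v)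
  have hφD : ∀ v : Metric.sphere (0 : E³) 1, φ (-v) = φ v := fun v =>
    hφ v (mem_sphere_zero_iff_norm.1 v.2)
  have hDU : ∀ v : Metric.sphere (0 : E³) 1, (φ v : ℝ × ℝ) ∈ upperChart →
      D v = (w₁ v)⁻¹ * w₁ (-v) := fun v hv => if_pos hv
  have hDL : ∀ v : Metric.sphere (0 : E³) 1, (φ v : ℝ × ℝ) ∈ lowerChart →
      D v = (w₂ v)⁻¹ * w₂ (-v) := by
    intro v hv
    by_cases hU : (φ v : ℝ × ℝ) ∈ upperChart
    · rw [hDU v hU, hw.compat v hU hv, hw.compat (-v) (by rwa [hφD]) (by rwa [hφD]), hφD]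
      group
    · exact if_neg hU
  have near : ∀ (U : Set (ℝ × ℝ)) (w : E³ → FreeGroup (Fin 3)), IsOpen U →
      (∀ v : Metric.sphere (0 : E³) 1, (φ v : ℝ × ℝ) ∈ U → D v = (w v)⁻¹ * w (-v)) →
      (∀ x, (φ x : ℝ × ℝ) ∈ U → ∀ᶠ y in 𝓝 x, w y = w x) →
      ∀ v : Metric.sphere (0 : E³) 1, (φ v : ℝ × ℝ) ∈ U → ∀ᶠ u in 𝓝 v, D u = D v := by
    intro U w hU hD hw v hv
    have hcont : Continuous fun u : Metric.sphere (0 : E³) 1 => (φ u : ℝ × ℝ) := by fun_prop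
    have hpos : Tendsto (fun u : Metric.sphere (0 : E³) 1 => (u : E³)) (𝓝 v) (𝓝 v) :=
      continuous_subtype_val.continuousAt
    have hneg : Tendsto (fun u : Metric.sphere (0 : E³) 1 => -(u : E³)) (𝓝 v) (𝓝 (-v)) :=
      continuous_subtype_val.neg.continuousAt
    filter_upwards [(hU.preimage hcont).mem_nhds hv, hpos.eventually (hw v hv),
      hneg.eventually (hw (-v) (by rwa [hφD]))] with u hu h1 h2
    rw [hD u hu, hD v hv, h1, h2]
  have hloc : IsLocallyConstant D := by
    rw [IsLocallyConstant.iff_eventually_eq]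
    intro v
    rcases mem_upperChart_or_lowerChart (φ v).2 with h | h
    · exact near _ w₁ isOpen_upperChart hDU hw.upper v h
    · exact near _ w₂ isOpen_lowerChart hDL hw.lower v h
  have : PreconnectedSpace (Metric.sphere (0 : E³) 1) :=
    isPreconnected_iff_preconnectedSpace.1
      (isPreconnected_sphere (by rw [← Module.finrank_eq_rank]; simp) 0 1)
  let v' : Metric.sphere (0 : E³) 1 := ⟨v, mem_sphere_zero_iff_norm.2 hv⟩
  have hinv : D (-v') = (D v')⁻¹ := by
    rcases mem_upperChart_or_lowerChart (φ v').2 with h | h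
    · rw [hDU v' h, hDU (-v') (by rw [coe_neg_sphere, hφD]; exact h)]
      simp
    · rw [hDL v' h, hDL (-v') (by rw [coe_neg_sphere, hφD]; exact h)]
      simp
  rw [hloc.apply_eq_of_preconnectedSpace (-v') v'] at hinv
  have hone : D v' = 1 := self_eq_inv.1 hinv
  refine ⟨fun h => ?_, fun h => ?_⟩
  · have := hDU v' h
    rw [hone] at this
    exact (inv_mul_eq_one.1 this.symm).symm
  · have := hDL v' h
    rw [hone] at this
    exact (inv_mul_eq_one.1 this.symm).symm

/-- Maps to the twice punctured plane from a Hausdorff quotient of the three-dimensional ball by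
the antipodal relation on the boundary, i.e. from real projective space, are nullhomotopic. -/
theorem nullhomotopic_of_antipodal_quotient {T : Type*} [TopologicalSpace T] [T2Space T]
    (β : C(E³, T)) (hsurj : ∀ t, ∃ v, ‖v‖ ≤ 1 ∧ β v = t)
    (hanti : ∀ v, ‖v‖ = 1 → β (-v) = β v)
    (hinj : ∀ u v, ‖u‖ ≤ 1 → ‖v‖ ≤ 1 → β u = β v → u = v ∨ ‖v‖ = 1 ∧ u = -v)
    (φ : C(T, puncturedPlane)) : φ.Nullhomotopic := by
  let q : Metric.closedBall (0 : E³) 1 → T := fun v => β v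
  have hq : Continuous q := by fun_prop
  have hqs : Function.Surjective q := fun t => by
    obtain ⟨v, hv, rfl⟩ := hsurj t
    exact ⟨⟨v, mem_closedBall_zero_iff.2 hv⟩, rfl⟩
  have : CompactSpace (Metric.closedBall (0 : E³) 1) :=
    isCompact_iff_compactSpace.1 (isCompact_closedBall _ _)
  have : ConnectedSpace (Metric.closedBall (0 : E³) 1) :=
    isConnected_iff_connectedSpace.1
      ((convex_closedBall _ _).isConnected ⟨0, by simp⟩)
  have : CompactSpace T := hqs.compactSpace hq
  have : ConnectedSpace T := hqs.connectedSpace hq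
  have hquot : IsQuotientMap q := hq.isClosedMap.isQuotientMap hq hqs
  obtain ⟨w₁, w₂, hw⟩ := exists_isLabelling FreeGroup.of (φ.comp β)
  have hanti' : ∀ v, ‖v‖ = 1 → (φ.comp β) (-v) = (φ.comp β) v := fun v hv => by
    simp [hanti v hv]
  choose sec hsec using hqs
  have descend : ∀ (U : Set (ℝ × ℝ)) (w : E³ → FreeGroup (Fin 3)), IsOpen U →
      (∀ v, ‖v‖ = 1 → ((φ.comp β) v : ℝ × ℝ) ∈ U → w (-v) = w v) →
      (∀ x, ((φ.comp β) x : ℝ × ℝ) ∈ U → ∀ᶠ y in 𝓝 x, w y = w x) →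
      ∀ t, (φ t : ℝ × ℝ) ∈ U → ∀ᶠ t' in 𝓝 t, w (sec t') = w (sec t) := by
    intro U w hU hwanti hw t ht
    have hlift : ∀ v : Metric.closedBall (0 : E³) 1, (φ (q v) : ℝ × ℝ) ∈ U →
        w (sec (q v)) = w v := by
      intro v hv
      rcases hinj (sec (q v)) v (mem_closedBall_zero_iff.1 (sec (q v)).2)
        (mem_closedBall_zero_iff.1 v.2) (hsec (q v)) with h | ⟨h1, h⟩
      · rw [h]
      · rw [h, hwanti v h1 hv]
    have hopen : IsOpen {t' | (φ t' : ℝ × ℝ) ∈ U ∧ w (sec t') = w (sec t)} := by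
      rw [← hquot.isOpen_preimage, isOpen_iff_mem_nhds]
      rintro v ⟨hv, hv'⟩
      have hcont : Continuous fun u : Metric.closedBall (0 : E³) 1 => (φ (q u) : ℝ × ℝ) := by
        fun_prop
      filter_upwards [(hU.preimage hcont).mem_nhds hv,
        continuous_subtype_val.continuousAt.eventually (hw v hv)] with u hu hu'
      exact ⟨hu, by rw [hlift u hu, hu', ← hlift v hv, hv']⟩
    filter_upwards [hopen.mem_nhds ⟨ht, rfl⟩] with t' ht'
    exact ht'.2
  refine IsLabelling.nullhomotopic_of_freeGroup (w₁ := fun t => w₁ (sec t))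
    (w₂ := fun t => w₂ (sec t)) ⟨?_, ?_, ?_⟩
  · exact descend _ w₁ isOpen_upperChart (fun v hv => (hw.antipodal_eq hanti' hv).1) hw.upper
  · exact descend _ w₂ isOpen_lowerChart (fun v hv => (hw.antipodal_eq hanti' hv).2) hw.lower
  · intro t ht ht'
    have h : (φ.comp β) (sec t) = φ t := congrArg φ (hsec t)
    have := hw.compat (sec t) (by rwa [h]) (by rwa [h])
    rwa [h] at this

/-- A symmetric matrix with vanishing two-by-two minors and trace one is the square of a vector. -/
lemma exists_mul_eq_of_minors {n : ℕ} (M : Fin n → Fin n → ℝ)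
    (hM : ∀ i j k, M i j * M i k = M i i * M j k) (htr : ∑ i, M i i = 1) :
    ∃ q : Fin n → ℝ, ∀ j k, q j * q k = M j k := by
  obtain ⟨i, -, hi⟩ : ∃ i ∈ Finset.univ, 0 < M i i := by
    by_contra! h
    linarith [Finset.sum_nonpos h]
  refine ⟨fun j => M i j / √(M i i), fun j k => ?_⟩
  rw [div_mul_div_comm, Real.mul_self_sqrt hi.le, hM, mul_div_cancel_left₀ _ hi.ne.symm]

/-- Every orthonormal frame comes from a unit quaternion. -/
lemma exists_quaternion {a₀ a₁ a₂ u₀ u₁ u₂ : ℝ} (ha : a₀ ^ 2 + a₁ ^ 2 + a₂ ^ 2 = 1)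
    (hu : u₀ ^ 2 + u₁ ^ 2 + u₂ ^ 2 = 1) (hau : a₀ * u₀ + a₁ * u₁ + a₂ * u₂ = 0) :
    ∃ q : Fin 4 → ℝ, 0 ≤ q 0 ∧ q 0 ^ 2 + q 1 ^ 2 + q 2 ^ 2 + q 3 ^ 2 = 1 ∧
      u₀ = q 0 ^ 2 + q 1 ^ 2 - q 2 ^ 2 - q 3 ^ 2 ∧ u₁ = 2 * (q 1 * q 2 + q 0 * q 3) ∧
      u₂ = 2 * (q 1 * q 3 - q 0 * q 2) ∧ a₀ = 2 * (q 1 * q 3 + q 0 * q 2) ∧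
      a₁ = 2 * (q 2 * q 3 - q 0 * q 1) ∧ a₂ = q 0 ^ 2 - q 1 ^ 2 - q 2 ^ 2 + q 3 ^ 2 := by
  obtain ⟨v₀, hv₀⟩ : ∃ v₀, v₀ = a₁ * u₂ - a₂ * u₁ := ⟨_, rfl⟩
  obtain ⟨v₁, hv₁⟩ : ∃ v₁, v₁ = a₂ * u₀ - a₀ * u₂ := ⟨_, rfl⟩
  obtain ⟨v₂, hv₂⟩ : ∃ v₂, v₂ = a₀ * u₁ - a₁ * u₀ := ⟨_, rfl⟩
  have hu₀ : u₀ = v₁ * a₂ - v₂ * a₁ := by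
    subst hv₁ hv₂; linear_combination (-u₀) * ha + a₀ * hau
  have hu₁ : u₁ = v₂ * a₀ - v₀ * a₂ := by
    subst hv₀ hv₂; linear_combination (-u₁) * ha + a₁ * hau
  have hu₂ : u₂ = v₀ * a₁ - v₁ * a₀ := by
    subst hv₀ hv₁; linear_combination (-u₂) * ha + a₂ * hau
  have ha₀ : a₀ = u₁ * v₂ - u₂ * v₁ := by
    subst hv₁ hv₂; linear_combination (-a₀) * hu + u₀ * hau
  have ha₁ : a₁ = u₂ * v₀ - u₀ * v₂ := by
    subst hv₀ hv₂; linear_combination (-a₁) * hu + u₁ * hau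
  have ha₂ : a₂ = u₀ * v₁ - u₁ * v₀ := by
    subst hv₀ hv₁; linear_combination (-a₂) * hu + u₂ * hau
  have hav : a₀ * v₀ + a₁ * v₁ + a₂ * v₂ = 0 := by subst hv₀ hv₁ hv₂; ring
  have huv : u₀ * v₀ + u₁ * v₁ + u₂ * v₂ = 0 := by subst hv₀ hv₁ hv₂; ring
  have hv : v₀ ^ 2 + v₁ ^ 2 + v₂ ^ 2 = 1 := by
    subst hv₀ hv₁ hv₂
    linear_combination (u₀ ^ 2 + u₁ ^ 2 + u₂ ^ 2) * ha + hu -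
      (a₀ * u₀ + a₁ * u₁ + a₂ * u₂) * hau
  let R : Matrix (Fin 3) (Fin 3) ℝ := !![u₀, v₀, a₀; u₁, v₁, a₁; u₂, v₂, a₂]
  have hR : R.transpose * R = 1 := by
    ext i j
    fin_cases i <;> fin_cases j <;> simp [R, Matrix.mul_apply, Fin.sum_univ_three] <;> linarith
  have hR' := mul_eq_one_comm.1 hR
  have h₀₀ := congrFun (congrFun hR' 0) 0
  have h₀₁ := congrFun (congrFun hR' 0) 1
  have h₀₂ := congrFun (congrFun hR' 0) 2
  have h₁₁ := congrFun (congrFun hR' 1) 1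
  have h₁₂ := congrFun (congrFun hR' 1) 2
  have h₂₂ := congrFun (congrFun hR' 2) 2
  simp [R, Matrix.mul_apply, Fin.sum_univ_three] at h₀₀ h₀₁ h₀₂ h₁₁ h₁₂ h₂₂
  obtain ⟨q, hq⟩ := exists_mul_eq_of_minors (n := 4)
    ![![(1 + u₀ + v₁ + a₂) / 4, (v₂ - a₁) / 4, (a₀ - u₂) / 4, (u₁ - v₀) / 4],
      ![(v₂ - a₁) / 4, (1 + u₀ - v₁ - a₂) / 4, (v₀ + u₁) / 4, (a₀ + u₂) / 4],
      ![(a₀ - u₂) / 4, (v₀ + u₁) / 4, (1 - u₀ + v₁ - a₂) / 4, (v₂ + a₁) / 4],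
      ![(u₁ - v₀) / 4, (a₀ + u₂) / 4, (v₂ + a₁) / 4, (1 - u₀ - v₁ + a₂) / 4]]
    (by
      clear hR hR'
      intro i j k
      fin_cases i <;> fin_cases j <;> fin_cases k <;> simp <;> linarith)
    (by simp [Fin.sum_univ_four]; ring)
  have q00 := hq 0 0
  have q11 := hq 1 1
  have q22 := hq 2 2
  have q33 := hq 3 3
  have q01 := hq 0 1
  have q02 := hq 0 2
  have q03 := hq 0 3
  have q12 := hq 1 2
  have q13 := hq 1 3
  have q23 := hq 2 3
  simp at q00 q11 q22 q33 q01 q02 q03 q12 q13 q23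
  rcases le_total 0 (q 0) with h | h
  · refine ⟨q, h, ?_, ?_, ?_, ?_, ?_, ?_, ?_⟩ <;> linarith
  · refine ⟨-q, by simpa using h, ?_, ?_, ?_, ?_, ?_, ?_, ?_⟩ <;> simp only [Pi.neg_apply] <;>
      linarith

/-- Two unit quaternions with the same rotation agree up to sign. -/
lemma quaternion_eq_or_eq_neg {p q : Fin 4 → ℝ}
    (hp : p 0 ^ 2 + p 1 ^ 2 + p 2 ^ 2 + p 3 ^ 2 = 1)
    (hq : q 0 ^ 2 + q 1 ^ 2 + q 2 ^ 2 + q 3 ^ 2 = 1)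
    (hu₀ : p 0 ^ 2 + p 1 ^ 2 - p 2 ^ 2 - p 3 ^ 2 = q 0 ^ 2 + q 1 ^ 2 - q 2 ^ 2 - q 3 ^ 2)
    (hu₁ : p 1 * p 2 + p 0 * p 3 = q 1 * q 2 + q 0 * q 3)
    (hu₂ : p 1 * p 3 - p 0 * p 2 = q 1 * q 3 - q 0 * q 2)
    (ha₀ : p 1 * p 3 + p 0 * p 2 = q 1 * q 3 + q 0 * q 2)
    (ha₁ : p 2 * p 3 - p 0 * p 1 = q 2 * q 3 - q 0 * q 1)
    (ha₂ : p 0 ^ 2 - p 1 ^ 2 - p 2 ^ 2 + p 3 ^ 2 = q 0 ^ 2 - q 1 ^ 2 - q 2 ^ 2 + q 3 ^ 2) :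
    p = q ∨ p = -q := by
  have hv₀ (r : Fin 4 → ℝ) (hr : r 0 ^ 2 + r 1 ^ 2 + r 2 ^ 2 + r 3 ^ 2 = 1) :
      r 1 * r 2 - r 0 * r 3 = 2 * (r 2 * r 3 - r 0 * r 1) * (r 1 * r 3 - r 0 * r 2) -
        (r 0 ^ 2 - r 1 ^ 2 - r 2 ^ 2 + r 3 ^ 2) * (r 1 * r 2 + r 0 * r 3) := by
    linear_combination (r 0 * r 3 - r 1 * r 2) * hr
  have hv₁ (r : Fin 4 → ℝ) (hr : r 0 ^ 2 + r 1 ^ 2 + r 2 ^ 2 + r 3 ^ 2 = 1) :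
      r 0 ^ 2 - r 1 ^ 2 + r 2 ^ 2 - r 3 ^ 2 =
        (r 0 ^ 2 - r 1 ^ 2 - r 2 ^ 2 + r 3 ^ 2) * (r 0 ^ 2 + r 1 ^ 2 - r 2 ^ 2 - r 3 ^ 2) -
        4 * (r 1 * r 3 + r 0 * r 2) * (r 1 * r 3 - r 0 * r 2) := by
    linear_combination (-(r 0 ^ 2 - r 1 ^ 2 + r 2 ^ 2 - r 3 ^ 2)) * hr
  have hv₂ (r : Fin 4 → ℝ) (hr : r 0 ^ 2 + r 1 ^ 2 + r 2 ^ 2 + r 3 ^ 2 = 1) :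
      r 2 * r 3 + r 0 * r 1 = 2 * (r 1 * r 3 + r 0 * r 2) * (r 1 * r 2 + r 0 * r 3) -
        (r 2 * r 3 - r 0 * r 1) * (r 0 ^ 2 + r 1 ^ 2 - r 2 ^ 2 - r 3 ^ 2) := by
    linear_combination (-(r 2 * r 3 + r 0 * r 1)) * hr
  have h₀ : p 1 * p 2 - p 0 * p 3 = q 1 * q 2 - q 0 * q 3 := by
    rw [hv₀ p hp, hv₀ q hq, ha₁, hu₂, ha₂, hu₁]
  have h₁ : p 0 ^ 2 - p 1 ^ 2 + p 2 ^ 2 - p 3 ^ 2 = q 0 ^ 2 - q 1 ^ 2 + q 2 ^ 2 - q 3 ^ 2 := by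
    rw [hv₁ p hp, hv₁ q hq, ha₂, hu₀, ha₀, hu₂]
  have h₂ : p 2 * p 3 + p 0 * p 1 = q 2 * q 3 + q 0 * q 1 := by
    rw [hv₂ p hp, hv₂ q hq, ha₀, hu₁, ha₁, hu₀]
  have hdot : (p 0 * q 0 + p 1 * q 1 + p 2 * q 2 + p 3 * q 3) ^ 2 = 1 := by
    have e00 : p 0 ^ 2 = q 0 ^ 2 := by linarith
    have e11 : p 1 ^ 2 = q 1 ^ 2 := by linarith
    have e22 : p 2 ^ 2 = q 2 ^ 2 := by linarith
    have e33 : p 3 ^ 2 = q 3 ^ 2 := by linarith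
    have e01 : p 0 * p 1 = q 0 * q 1 := by linarith
    have e02 : p 0 * p 2 = q 0 * q 2 := by linarith
    have e03 : p 0 * p 3 = q 0 * q 3 := by linarith
    have e12 : p 1 * p 2 = q 1 * q 2 := by linarith
    have e13 : p 1 * p 3 = q 1 * q 3 := by linarith
    have e23 : p 2 * p 3 = q 2 * q 3 := by linarith
    linear_combination (q 0 ^ 2) * e00 + (q 1 ^ 2) * e11 + (q 2 ^ 2) * e22 + (q 3 ^ 2) * e33 +
      2 * (q 0 * q 1) * e01 + 2 * (q 0 * q 2) * e02 + 2 * (q 0 * q 3) * e03 +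
      2 * (q 1 * q 2) * e12 + 2 * (q 1 * q 3) * e13 + 2 * (q 2 * q 3) * e23 +
      (q 0 ^ 2 + q 1 ^ 2 + q 2 ^ 2 + q 3 ^ 2 + 1) * hq
  rcases sq_eq_sq_iff_eq_or_eq_neg.1 (hdot.trans (one_pow 2).symm) with h | h
  · left
    have hsum : ∑ i, (p i - q i) ^ 2 = 0 := by
      rw [Fin.sum_univ_four]; linear_combination hp + hq - 2 * h
    funext i
    have := (Finset.sum_eq_zero_iff_of_nonneg fun i _ => sq_nonneg _).1 hsum i (Finset.mem_univ i)
    linarith [pow_eq_zero_iff two_ne_zero |>.1 this]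
  · right
    have hsum : ∑ i, (p i + q i) ^ 2 = 0 := by
      rw [Fin.sum_univ_four]; linear_combination hp + hq + 2 * h
    funext i
    have := (Finset.sum_eq_zero_iff_of_nonneg fun i _ => sq_nonneg _).1 hsum i (Finset.mem_univ i)
    simp only [Pi.neg_apply]
    linarith [pow_eq_zero_iff two_ne_zero |>.1 this]

/-- Orthonormal pairs of vectors in `ℝ³`. -/
abbrev FrameSpace : Type :=
  {p : E³ × E³ // ‖p.1‖ = 1 ∧ ‖p.2‖ = 1 ∧ inner ℝ p.1 p.2 = 0}

/-- The third and first columns of the rotation matrix of a quaternion. -/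
noncomputable def quaternionFrame (q : Fin 4 → ℝ) : E³ × E³ :=
  (!₂[2 * (q 1 * q 3 + q 0 * q 2), 2 * (q 2 * q 3 - q 0 * q 1),
      q 0 ^ 2 - q 1 ^ 2 - q 2 ^ 2 + q 3 ^ 2],
    !₂[q 0 ^ 2 + q 1 ^ 2 - q 2 ^ 2 - q 3 ^ 2, 2 * (q 1 * q 2 + q 0 * q 3),
      2 * (q 1 * q 3 - q 0 * q 2)])

lemma continuous_quaternionFrame : Continuous quaternionFrame := by
  unfold quaternionFrame
  refine Continuous.prodMk ?_ ?_ <;>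
  · refine (PiLp.continuous_toLp 2 _).comp (continuous_pi fun i => ?_)
    fin_cases i <;> simp <;> fun_prop

lemma quaternionFrame_spec {q : Fin 4 → ℝ}
    (hq : q 0 ^ 2 + q 1 ^ 2 + q 2 ^ 2 + q 3 ^ 2 = 1) :
    ‖(quaternionFrame q).1‖ = 1 ∧ ‖(quaternionFrame q).2‖ = 1 ∧
      inner ℝ (quaternionFrame q).1 (quaternionFrame q).2 = 0 := by
  refine ⟨?_, ?_, ?_⟩
  · rw [EuclideanSpace.norm_eq, Real.sqrt_eq_one]
    simp [quaternionFrame, Fin.sum_univ_three]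
    linear_combination (q 0 ^ 2 + q 1 ^ 2 + q 2 ^ 2 + q 3 ^ 2 + 1) * hq
  · rw [EuclideanSpace.norm_eq, Real.sqrt_eq_one]
    simp [quaternionFrame, Fin.sum_univ_three]
    linear_combination (q 0 ^ 2 + q 1 ^ 2 + q 2 ^ 2 + q 3 ^ 2 + 1) * hq
  · simp [quaternionFrame, PiLp.inner_apply, Fin.sum_univ_three]
    ring

/-- The unit quaternion with nonnegative real part and imaginary part `v`, for `v` in the unit
ball, extended to all of `ℝ³` by radial projection. -/
noncomputable def ballQuaternion (v : E³) : Fin 4 → ℝ :=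
  ![√(1 - ‖v‖ ^ 2), v 0 / max 1 ‖v‖, v 1 / max 1 ‖v‖, v 2 / max 1 ‖v‖]

lemma continuous_ballQuaternion : Continuous ballQuaternion := by
  have h (v : E³) : max 1 ‖v‖ ≠ 0 := (lt_max_of_lt_left one_pos).ne'
  refine continuous_pi fun i => ?_
  fin_cases i <;> simp [ballQuaternion] <;> fun_prop (disch := exact h)

lemma norm_sq_eq_coords (v : E³) : ‖v‖ ^ 2 = v 0 ^ 2 + v 1 ^ 2 + v 2 ^ 2 := by
  simp [EuclideanSpace.norm_sq_eq, Fin.sum_univ_three]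

lemma ballQuaternion_norm (v : E³) :
    ballQuaternion v 0 ^ 2 + ballQuaternion v 1 ^ 2 + ballQuaternion v 2 ^ 2 +
      ballQuaternion v 3 ^ 2 = 1 := by
  have hN := norm_sq_eq_coords v
  have h0 := norm_nonneg v
  rcases le_total ‖v‖ 1 with h | h
  · simp only [ballQuaternion, max_eq_left h, Matrix.cons_val]
    rw [Real.sq_sqrt (by nlinarith)]
    linarith
  · have : ‖v‖ ≠ 0 := by linarith
    simp only [ballQuaternion, max_eq_right h, Matrix.cons_val]
    rw [Real.sqrt_eq_zero_of_nonpos (by nlinarith)]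
    field_simp
    linarith

lemma ballQuaternion_of_norm_le {v : E³} (hv : ‖v‖ ≤ 1) :
    ballQuaternion v = ![√(1 - ‖v‖ ^ 2), v 0, v 1, v 2] := by
  simp [ballQuaternion, max_eq_left hv]

/-- The closed ball of `ℝ³` covers the frame space through unit quaternions. -/
noncomputable def ballFrame : C(E³, FrameSpace) where
  toFun v := ⟨quaternionFrame (ballQuaternion v), quaternionFrame_spec (ballQuaternion_norm v)⟩
  continuous_toFun :=
    (continuous_quaternionFrame.comp continuous_ballQuaternion).subtype_mk _

theorem FrameSpace.nullhomotopic (φ : C(FrameSpace, puncturedPlane)) : φ.Nullhomotopic := by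
  refine nullhomotopic_of_antipodal_quotient ballFrame ?_ ?_ ?_ φ
  · rintro ⟨⟨a, u⟩, ha, hu, hau⟩
    have ha' := norm_sq_eq_coords a
    have hu' := norm_sq_eq_coords u
    simp only at ha hu hau
    rw [ha, one_pow] at ha'
    rw [hu, one_pow] at hu'
    rw [PiLp.inner_apply, Fin.sum_univ_three] at hau
    simp only [RCLike.inner_apply, conj_trivial] at hau
    obtain ⟨q, hq0, hq, h1, h2, h3, h4, h5, h6⟩ := exists_quaternion ha'.symm hu'.symm
      (by linarith)
    have hn : ‖(!₂[q 1, q 2, q 3] : E³)‖ ^ 2 = 1 - q 0 ^ 2 := by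
      rw [norm_sq_eq_coords]; simp; linarith
    have hle : ‖(!₂[q 1, q 2, q 3] : E³)‖ ≤ 1 := by
      nlinarith [sq_nonneg (q 0), norm_nonneg (!₂[q 1, q 2, q 3] : E³)]
    refine ⟨!₂[q 1, q 2, q 3], hle, Subtype.ext ?_⟩
    have hbq : ballQuaternion !₂[q 1, q 2, q 3] = q := by
      rw [ballQuaternion_of_norm_le hle, hn]
      funext i
      fin_cases i <;> simp [Real.sqrt_sq hq0]
    simp only [ballFrame, ContinuousMap.coe_mk, hbq, quaternionFrame]
    ext i <;> fin_cases i <;> simp [h1, h2, h3, h4, h5, h6]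
  · intro v hv
    refine Subtype.ext ?_
    simp [ballFrame, ballQuaternion, quaternionFrame, hv]
  · intro u v hu hv huv
    have h := congrArg Subtype.val huv
    simp only [ballFrame, ContinuousMap.coe_mk, quaternionFrame, Prod.mk.injEq] at h
    have hc (i : Fin 3) := And.intro (congrArg (fun w : E³ => w i) h.1)
      (congrArg (fun w : E³ => w i) h.2)
    have hc0 := hc 0
    have hc1 := hc 1
    have hc2 := hc 2
    simp only [Matrix.cons_val, mul_eq_mul_left_iff, OfNat.ofNat_ne_zero, or_false] at hc0 hc1 hc2
    have key := quaternion_eq_or_eq_neg (ballQuaternion_norm u) (ballQuaternion_norm v)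
      hc0.2 hc1.2 hc2.2 hc0.1 hc1.1 hc2.1
    rw [ballQuaternion_of_norm_le hu, ballQuaternion_of_norm_le hv] at key
    rcases key with key | key
    · left
      ext i
      fin_cases i
      · simpa using congrFun key 1
      · simpa using congrFun key 2
      · simpa using congrFun key 3
    · right
      have h0 := congrFun key 0
      simp at h0
      have h0' := Real.sqrt_nonneg (1 - ‖u‖ ^ 2)
      have h0'' := Real.sqrt_nonneg (1 - ‖v‖ ^ 2)
      have h1 : √(1 - ‖v‖ ^ 2) = 0 := by linarith
      rw [Real.sqrt_eq_zero (by nlinarith [norm_nonneg v])] at h1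
      refine ⟨by nlinarith [norm_nonneg v], ?_⟩
      ext i
      fin_cases i
      · simpa using congrFun key 1
      · simpa using congrFun key 2
      · simpa using congrFun key 3

section Stereographic

variable {V : Type*} [NormedAddCommGroup V] [InnerProductSpace ℝ V]

/-- Stereographic projection from `a` onto the orthogonal complement of `a`. -/
noncomputable def stereoProj (a v : V) : V := (1 - inner ℝ v a)⁻¹ • (v - inner ℝ v a • a)

/-- The inverse of stereographic projection from `a`. -/
noncomputable def stereoLift (a w : V) : V :=
  (‖w‖ ^ 2 + 1)⁻¹ • ((2 : ℝ) • w + (‖w‖ ^ 2 - 1) • a)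

lemma inner_stereoProj {a : V} (ha : ‖a‖ = 1) (v : V) : inner ℝ (stereoProj a v) a = 0 := by
  simp [stereoProj, inner_smul_left, inner_sub_left, ha]

lemma inner_stereoLift {a w : V} (ha : ‖a‖ = 1) (hw : inner ℝ w a = 0) :
    inner ℝ (stereoLift a w) a = (‖w‖ ^ 2 + 1)⁻¹ * (‖w‖ ^ 2 - 1) := by
  simp [stereoLift, inner_smul_left, inner_add_left, ha, hw]

lemma norm_stereoLift {a w : V} (ha : ‖a‖ = 1) (hw : inner ℝ w a = 0) :
    ‖stereoLift a w‖ = 1 := by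
  have h : ‖(2 : ℝ) • w + (‖w‖ ^ 2 - 1) • a‖ ^ 2 = (‖w‖ ^ 2 + 1) ^ 2 := by
    rw [norm_add_sq_real]
    simp only [norm_smul, inner_smul_left, inner_smul_right, hw, ha, Real.norm_eq_abs, mul_pow,
      sq_abs, conj_trivial]
    ring
  have hpos : 0 < ‖w‖ ^ 2 + 1 := by positivity
  have h' : ‖(2 : ℝ) • w + (‖w‖ ^ 2 - 1) • a‖ = ‖w‖ ^ 2 + 1 :=
    (sq_eq_sq₀ (norm_nonneg _) hpos.le).1 h
  rw [stereoLift, norm_smul, h', norm_inv, Real.norm_of_nonneg hpos.le, inv_mul_cancel₀ hpos.ne']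

lemma stereoLift_ne {a w : V} (ha : ‖a‖ = 1) (hw : inner ℝ w a = 0) : stereoLift a w ≠ a := by
  intro h
  have h1 := inner_stereoLift ha hw
  have hpos : ‖w‖ ^ 2 + 1 ≠ 0 := by positivity
  rw [h, real_inner_self_eq_norm_sq, ha] at h1
  field_simp at h1
  linarith

lemma stereoProj_stereoLift {a w : V} (ha : ‖a‖ = 1) (hw : inner ℝ w a = 0) :
    stereoProj a (stereoLift a w) = w := by
  have hpos : ‖w‖ ^ 2 + 1 ≠ 0 := by positivity
  have h1 : 1 - (‖w‖ ^ 2 + 1)⁻¹ * (‖w‖ ^ 2 - 1) = 2 * (‖w‖ ^ 2 + 1)⁻¹ := by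
    field_simp; ring
  rw [stereoProj, inner_stereoLift ha hw, h1, stereoLift, smul_add, smul_smul, smul_smul,
    add_sub_cancel_right, smul_smul]
  convert one_smul ℝ w using 2
  field_simp

lemma stereoLift_stereoProj {a v : V} (ha : ‖a‖ = 1) (hv : ‖v‖ = 1) (hne : v ≠ a) :
    stereoLift a (stereoProj a v) = v := by
  have hlt : 0 < 1 - inner ℝ v a := by
    linarith [(inner_lt_one_iff_real_of_norm_eq_one hv ha).2 hne]
  obtain ⟨c, hc⟩ : ∃ c : ℝ, c = inner ℝ v a := ⟨_, rfl⟩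
  have hn : ‖stereoProj a v‖ ^ 2 = (1 + c) / (1 - c) := by
    rw [stereoProj, norm_smul, mul_pow, norm_sub_sq_real, inner_smul_right, norm_smul, norm_inv,
      Real.norm_of_nonneg hlt.le, hv, ha, ← hc, mul_one, Real.norm_eq_abs, sq_abs]
    rw [← hc] at hlt
    field_simp
    ring
  rw [stereoLift, hn, stereoProj, ← hc]
  rw [← hc] at hlt
  have h1 : (1 + c) / (1 - c) + 1 = 2 * (1 - c)⁻¹ := by field_simp; ring
  have h2 : (1 + c) / (1 - c) - 1 = 2 * (1 - c)⁻¹ * c := by field_simp; ring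
  rw [h1, h2, smul_smul, mul_smul _ c a, ← smul_add, sub_add_cancel, smul_smul,
    inv_mul_cancel₀ (by positivity), one_smul]

lemma continuous_stereoLift {X : Type*} [TopologicalSpace X] {f g : X → V} (hf : Continuous f)
    (hg : Continuous g) : Continuous fun x => stereoLift (f x) (g x) := by
  have h (x : X) : ‖g x‖ ^ 2 + 1 ≠ 0 := by positivity
  unfold stereoLift
  fun_prop (disch := exact h)

lemma continuous_stereoProj {X : Type*} [TopologicalSpace X] {f g : X → V} (hf : Continuous f)
    (hg : Continuous g) (hf1 : ∀ x, ‖f x‖ = 1) (hg1 : ∀ x, ‖g x‖ = 1) (hne : ∀ x, g x ≠ f x) :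
    Continuous fun x => stereoProj (f x) (g x) := by
  have h (x : X) : 1 - inner ℝ (g x) (f x) ≠ 0 := by
    exact (sub_pos.2 ((inner_lt_one_iff_real_of_norm_eq_one (hg1 x) (hf1 x)).2 (hne x))).ne'
  unfold stereoProj
  fun_prop (disch := exact h)

end Stereographic

/-- The cross product on Euclidean three-space. -/
noncomputable def euclideanCross (a e : E³) : E³ :=
  !₂[a 1 * e 2 - a 2 * e 1, a 2 * e 0 - a 0 * e 2, a 0 * e 1 - a 1 * e 0]

lemma inner_eq_coords (v w : E³) : inner ℝ v w = v 0 * w 0 + v 1 * w 1 + v 2 * w 2 := by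
  simp [PiLp.inner_apply, Fin.sum_univ_three, mul_comm]

lemma continuous_euclideanCross {X : Type*} [TopologicalSpace X] {f g : X → E³}
    (hf : Continuous f) (hg : Continuous g) : Continuous fun x => euclideanCross (f x) (g x) := by
  refine (PiLp.continuous_toLp 2 _).comp (continuous_pi fun i => ?_)
  fin_cases i <;> simp <;> fun_prop

lemma inner_euclideanCross_left (a e : E³) : inner ℝ (euclideanCross a e) a = 0 := by
  rw [inner_eq_coords]; simp [euclideanCross]; ring

lemma inner_euclideanCross_right (a e : E³) : inner ℝ (euclideanCross a e) e = 0 := by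
  rw [inner_eq_coords]; simp [euclideanCross]; ring

lemma norm_sq_euclideanCross {a e : E³} (ha : ‖a‖ = 1) (he : inner ℝ e a = 0) :
    ‖euclideanCross a e‖ ^ 2 = ‖e‖ ^ 2 := by
  have ha' := norm_sq_eq_coords a
  rw [ha] at ha'
  rw [inner_eq_coords] at he
  rw [norm_sq_eq_coords, norm_sq_eq_coords]
  simp only [euclideanCross, Matrix.cons_val]
  linear_combination (-(e 0 ^ 2 + e 1 ^ 2 + e 2 ^ 2)) * ha' -
    (e 0 * a 0 + e 1 * a 1 + e 2 * a 2) * he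

/-- The orthogonal decomposition of a vector of the plane `a⊥` along `e` and `a × e`. -/
lemma smul_eq_add_euclideanCross {a e w : E³} (ha : ‖a‖ = 1) (he : inner ℝ e a = 0)
    (hw : inner ℝ w a = 0) :
    ‖e‖ ^ 2 • w = inner ℝ w e • e + inner ℝ w (euclideanCross a e) • euclideanCross a e := by
  have ha' := norm_sq_eq_coords a
  rw [ha] at ha'
  rw [inner_eq_coords] at he hw
  have hc (i : Fin 3) : inner ℝ w (euclideanCross a e) * a i = euclideanCross e w i := by
    rw [inner_eq_coords]
    fin_cases i
    · simp [euclideanCross]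
      linear_combination (-(e 1 * w 2 - e 2 * w 1)) * ha' - (w 2 * a 1 - w 1 * a 2) * he -
        (e 1 * a 2 - e 2 * a 1) * hw
    · simp [euclideanCross]
      linear_combination (-(e 2 * w 0 - e 0 * w 2)) * ha' - (w 0 * a 2 - w 2 * a 0) * he -
        (e 2 * a 0 - e 0 * a 2) * hw
    · simp [euclideanCross]
      linear_combination (-(e 0 * w 1 - e 1 * w 0)) * ha' - (w 1 * a 0 - w 0 * a 1) * he -
        (e 0 * a 1 - e 1 * a 0) * hw
  have h0 := hc 0
  have h1 := hc 1
  have h2 := hc 2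
  generalize inner ℝ w (euclideanCross a e) = t at *
  rw [norm_sq_eq_coords, inner_eq_coords]
  simp only [euclideanCross, Matrix.cons_val] at h0 h1 h2
  ext i
  fin_cases i
  · simp [euclideanCross]
    linear_combination (-e 2) * h1 + e 1 * h2
  · simp [euclideanCross]
    linear_combination (-e 0) * h2 + e 2 * h0
  · simp [euclideanCross]
    linear_combination (-e 1) * h0 + e 0 * h1

/-- Triples `(a, p, e)` of a unit vector `a`, a point `p` of the plane `a⊥` and a nonzero vector
`e` of that plane. -/
abbrev PlanarPair : Type :=
  {z : E³ × E³ × E³ // ‖z.1‖ = 1 ∧ inner ℝ z.2.1 z.1 = 0 ∧ inner ℝ z.2.2 z.1 = 0 ∧ z.2.2 ≠ 0}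

lemma injective_vecCons_three {α : Type*} {a b c : α} (hab : a ≠ b) (hac : a ≠ c) (hbc : b ≠ c) :
    Function.Injective ![a, b, c] := by
  intro i j hij
  fin_cases i <;> fin_cases j <;> simp_all [eq_comm]

namespace PlanarPair

/-- Lift a point of the plane `a⊥` to the sphere. -/
noncomputable def lift (z : PlanarPair) (w : E³) (hw : inner ℝ w z.1.1 = 0) : Sphere2 :=
  ⟨stereoLift z.1.1 w, by simpa using norm_stereoLift z.2.1 hw⟩

lemma lift_injective (z : PlanarPair) {w w' : E³} (hw : inner ℝ w z.1.1 = 0)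
    (hw' : inner ℝ w' z.1.1 = 0) (h : z.lift w hw = z.lift w' hw') : w = w' := by
  rw [← stereoProj_stereoLift z.2.1 hw, ← stereoProj_stereoLift z.2.1 hw']
  exact congrArg (stereoProj z.1.1) (congrArg Subtype.val h)

lemma inner_add_eq_zero (z : PlanarPair) : inner ℝ (z.1.2.1 + z.1.2.2) z.1.1 = 0 := by
  rw [inner_add_left, z.2.2.1, z.2.2.2.1, add_zero]

/-- The configuration of `a` and the lifts of `p` and `p + e`. -/
noncomputable def toPConf : C(PlanarPair, PConf 3 Sphere2) where
  toFun z := ⟨![⟨z.1.1, by simpa using z.2.1⟩, z.lift z.1.2.1 z.2.2.1,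
      z.lift (z.1.2.1 + z.1.2.2) z.inner_add_eq_zero], by
    refine injective_vecCons_three
      (fun h => stereoLift_ne z.2.1 z.2.2.1 (congrArg Subtype.val h).symm)
      (fun h => stereoLift_ne z.2.1 z.inner_add_eq_zero (congrArg Subtype.val h).symm)
      (fun h => z.2.2.2.2 ?_)
    simpa using z.lift_injective _ _ h⟩
  continuous_toFun := by
    refine Continuous.subtype_mk (continuous_pi fun i => ?_) _
    fin_cases i
    · exact Continuous.subtype_mk (by fun_prop) _
    · exact Continuous.subtype_mk (continuous_stereoLift (by fun_prop) (by fun_prop)) _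
    · exact Continuous.subtype_mk (continuous_stereoLift (by fun_prop) (by fun_prop)) _

end PlanarPair

lemma PConf.coe_ne {n : ℕ} (x : PConf n Sphere2) {i j : Fin n} (h : i ≠ j) :
    (x.1 i : E³) ≠ x.1 j :=
  fun h' => h (x.2 (Subtype.ext h'))

lemma PConf.continuous_coe_apply {n : ℕ} (i : Fin n) :
    Continuous fun x : PConf n Sphere2 => (x.1 i : E³) :=
  continuous_subtype_val.comp ((continuous_apply i).comp continuous_subtype_val)

lemma Sphere2.norm_eq (v : Sphere2) : ‖(v : E³)‖ = 1 := by simp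

/-- Stereographic projection of the last two points of a configuration from its first point. -/
noncomputable def PConf.toPlanarPair : C(PConf 3 Sphere2, PlanarPair) where
  toFun x := ⟨(x.1 0, stereoProj (x.1 0 : E³) (x.1 1),
      stereoProj (x.1 0 : E³) (x.1 2) - stereoProj (x.1 0 : E³) (x.1 1)),
    Sphere2.norm_eq _, inner_stereoProj (Sphere2.norm_eq _) _, by
      rw [inner_sub_left, inner_stereoProj (Sphere2.norm_eq _),
        inner_stereoProj (Sphere2.norm_eq _), sub_zero], by
      intro h
      have h' := congrArg (stereoLift (x.1 0 : E³)) (sub_eq_zero.1 h)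
      rw [stereoLift_stereoProj (Sphere2.norm_eq _) (Sphere2.norm_eq _) (x.coe_ne (by decide)),
        stereoLift_stereoProj (Sphere2.norm_eq _) (Sphere2.norm_eq _) (x.coe_ne (by decide))] at h'
      exact x.coe_ne (by decide) h'⟩
  continuous_toFun := by
    have hc (i : Fin 3) := PConf.continuous_coe_apply i
    have hs (i : Fin 3) (hi : i ≠ 0) :
        Continuous fun x : PConf 3 Sphere2 => stereoProj (x.1 0 : E³) (x.1 i) :=
      continuous_stereoProj (hc 0) (hc i) (fun _ => Sphere2.norm_eq _)
        (fun _ => Sphere2.norm_eq _) (fun x => x.coe_ne hi)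
    exact Continuous.subtype_mk ((hc 0).prodMk ((hs 1 (by decide)).prodMk
      ((hs 2 (by decide)).sub (hs 1 (by decide))))) _

lemma PConf.stereoLift_toPlanarPair_fst (x : PConf 3 Sphere2) :
    stereoLift (x.1 0 : E³) x.toPlanarPair.1.2.1 = x.1 1 :=
  stereoLift_stereoProj (Sphere2.norm_eq _) (Sphere2.norm_eq _) (x.coe_ne (by decide))

lemma PConf.stereoLift_toPlanarPair_add (x : PConf 3 Sphere2) :
    stereoLift (x.1 0 : E³) (x.toPlanarPair.1.2.1 + x.toPlanarPair.1.2.2) = x.1 2 := by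
  have h := stereoLift_stereoProj (Sphere2.norm_eq (x.1 0)) (Sphere2.norm_eq (x.1 2))
    (x.coe_ne (by decide))
  simpa [PConf.toPlanarPair] using h

lemma PConf.toPConf_toPlanarPair (x : PConf 3 Sphere2) :
    PlanarPair.toPConf x.toPlanarPair = x := by
  refine Subtype.ext (funext fun i => Subtype.ext ?_)
  fin_cases i
  · rfl
  · exact x.stereoLift_toPlanarPair_fst
  · exact x.stereoLift_toPlanarPair_add

namespace PlanarPair

/-- Normalise `e`. -/
noncomputable def toFrame : C(PlanarPair, FrameSpace) where
  toFun z := ⟨(z.1.1, ‖z.1.2.2‖⁻¹ • z.1.2.2), z.2.1, by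
      simpa using norm_smul_inv_norm (𝕜 := ℝ) z.2.2.2.2, by
      rw [inner_smul_right, real_inner_comm, z.2.2.2.1, mul_zero]⟩
  continuous_toFun := by
    have h (z : PlanarPair) : ‖z.1.2.2‖ ≠ 0 := norm_ne_zero_iff.2 z.2.2.2.2
    exact Continuous.subtype_mk (by fun_prop (disch := exact h)) _

/-- The frames as planar pairs with `p = 0` and `e` of length one. -/
noncomputable def ofFrame : C(FrameSpace, PlanarPair) where
  toFun t := ⟨(t.1.1, 0, t.1.2), t.2.1, inner_zero_left _, by
      rw [real_inner_comm]; exact t.2.2.2, by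
      rw [← norm_ne_zero_iff, t.2.2.1]; exact one_ne_zero⟩
  continuous_toFun := Continuous.subtype_mk (by fun_prop) _

lemma homotopic_ofFrame_toFrame :
    (ContinuousMap.id PlanarPair).Homotopic (ofFrame.comp toFrame) := by
  have hpos (y : I × PlanarPair) : 0 < (1 - (y.1 : ℝ)) + y.1 * ‖y.2.1.2.2‖⁻¹ := by
    have h0 : 0 < ‖y.2.1.2.2‖⁻¹ := inv_pos.2 (norm_pos_iff.2 y.2.2.2.2.2)
    rcases y.1.2.1.eq_or_lt with h | h
    · simp [← h]
    · linarith [mul_pos h h0, y.1.2.2]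
  have hne (y : I × PlanarPair) : ‖y.2.1.2.2‖ ≠ 0 := norm_ne_zero_iff.2 y.2.2.2.2.2
  refine ⟨{
    toFun := fun y => ⟨(y.2.1.1, (1 - (y.1 : ℝ)) • y.2.1.2.1,
        ((1 - (y.1 : ℝ)) + y.1 * ‖y.2.1.2.2‖⁻¹) • y.2.1.2.2), y.2.2.1, by
      rw [inner_smul_left, y.2.2.2.1, mul_zero], by
      rw [inner_smul_left, y.2.2.2.2.1, mul_zero],
      smul_ne_zero (hpos y).ne' y.2.2.2.2.2⟩
    continuous_toFun := Continuous.subtype_mk (by fun_prop (disch := exact hne)) _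
    map_zero_left := fun z => Subtype.ext (by simp)
    map_one_left := fun z => Subtype.ext (by simp [ofFrame, toFrame]) }⟩

/-- The point of the plane `a⊥` with coordinates `ζ` in the frame `(e, a × e)`
based at `p`. -/
noncomputable def planePoint (z : PlanarPair) (ζ : ℝ × ℝ) : E³ :=
  z.1.2.1 + (ζ.1 • z.1.2.2 + ζ.2 • euclideanCross z.1.1 z.1.2.2)

lemma inner_planePoint (z : PlanarPair) (ζ : ℝ × ℝ) :
    inner ℝ (z.planePoint ζ) z.1.1 = 0 := by
  simp [planePoint, inner_add_left, inner_smul_left, z.2.2.1, z.2.2.2.1,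
    inner_euclideanCross_left]

lemma planePoint_injective (z : PlanarPair) : Function.Injective z.planePoint := by
  intro ζ ζ' h
  have h' : (ζ.1 - ζ'.1) • z.1.2.2 + (ζ.2 - ζ'.2) • euclideanCross z.1.1 z.1.2.2 = 0 := by
    have := sub_eq_zero.2 h
    rw [planePoint, planePoint] at this
    exact Eq.trans (by module) this
  have hpos : ‖z.1.2.2‖ ^ 2 ≠ 0 := pow_ne_zero _ (norm_ne_zero_iff.2 z.2.2.2.2)
  have h1 := congrArg (fun w => inner ℝ w z.1.2.2) h'
  have h2 := congrArg (fun w => inner ℝ w (euclideanCross z.1.1 z.1.2.2)) h'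
  simp only [inner_add_left, inner_smul_left, inner_euclideanCross_right, inner_zero_left,
    real_inner_self_eq_norm_sq, norm_sq_euclideanCross z.2.1 z.2.2.2.1, conj_trivial, mul_zero,
    add_zero] at h1 h2
  rw [real_inner_comm, inner_euclideanCross_right, mul_zero, zero_add] at h2
  exact Prod.ext (sub_eq_zero.1 ((mul_eq_zero.1 h1).resolve_right hpos))
    (sub_eq_zero.1 ((mul_eq_zero.1 h2).resolve_right hpos))

lemma continuous_planePoint :
    Continuous fun y : PlanarPair × (ℝ × ℝ) => y.1.planePoint y.2 := by
  have h := continuous_euclideanCross (f := fun y : PlanarPair × (ℝ × ℝ) => y.1.1.1)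
    (g := fun y => y.1.1.2.2) (by fun_prop) (by fun_prop)
  unfold planePoint
  fun_prop

/-- The coordinates of a point of the plane `a⊥` in the frame `(e, a × e)` based at `p`. -/
noncomputable def planeCoord (z : PlanarPair) (w : E³) : ℝ × ℝ :=
  (inner ℝ (w - z.1.2.1) z.1.2.2 / ‖z.1.2.2‖ ^ 2,
    inner ℝ (w - z.1.2.1) (euclideanCross z.1.1 z.1.2.2) / ‖z.1.2.2‖ ^ 2)

lemma continuous_planeCoord :
    Continuous fun y : PlanarPair × E³ => y.1.planeCoord y.2 := by
  have h := continuous_euclideanCross (f := fun y : PlanarPair × E³ => y.1.1.1)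
    (g := fun y => y.1.1.2.2) (by fun_prop) (by fun_prop)
  have hpos (y : PlanarPair × E³) : ‖y.1.1.2.2‖ ^ 2 ≠ 0 :=
    pow_ne_zero _ (norm_ne_zero_iff.2 y.1.2.2.2.2)
  unfold planeCoord
  fun_prop (disch := exact hpos)

lemma planePoint_planeCoord (z : PlanarPair) {w : E³} (hw : inner ℝ w z.1.1 = 0) :
    z.planePoint (z.planeCoord w) = w := by
  have hpos : ‖z.1.2.2‖ ^ 2 ≠ 0 := pow_ne_zero _ (norm_ne_zero_iff.2 z.2.2.2.2)
  have h := smul_eq_add_euclideanCross z.2.1 z.2.2.2.1 (w := w - z.1.2.1)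
    (by rw [inner_sub_left, hw, z.2.2.1, sub_zero])
  rw [planePoint, planeCoord, div_eq_inv_mul, div_eq_inv_mul, mul_smul, mul_smul, ← smul_add,
    ← h, inv_smul_smul₀ hpos, add_sub_cancel]

lemma planePoint_zero (z : PlanarPair) : z.planePoint (0, 0) = z.1.2.1 := by
  simp [planePoint]

lemma planePoint_one (z : PlanarPair) : z.planePoint (1, 0) = z.1.2.1 + z.1.2.2 := by
  simp [planePoint]

end PlanarPair

lemma mem_puncturedPlane_iff {ζ : ℝ × ℝ} : ζ ∈ puncturedPlane ↔ ζ ≠ (0, 0) ∧ ζ ≠ (1, 0) := by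
  rcases ζ with ⟨s, t⟩
  simp only [puncturedPlane, mem_ofPred_eq, ne_eq, Prod.mk.injEq]
  tauto

theorem PConf.nullhomotopic (ψ : C(PConf 3 Sphere2, puncturedPlane)) : ψ.Nullhomotopic := by
  have hψ : ψ = (ψ.comp PlanarPair.toPConf).comp PConf.toPlanarPair := by
    ext1 x
    simp [PConf.toPConf_toPlanarPair]
  have hT : ((ψ.comp PlanarPair.toPConf).comp
      (PlanarPair.ofFrame.comp PlanarPair.toFrame)).Nullhomotopic :=
    (FrameSpace.nullhomotopic ((ψ.comp PlanarPair.toPConf).comp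
      PlanarPair.ofFrame)).comp_left PlanarPair.toFrame
  obtain ⟨y, hy⟩ := hT
  have hP : (ψ.comp PlanarPair.toPConf).Nullhomotopic :=
    ⟨y, ((ContinuousMap.Homotopic.refl (ψ.comp PlanarPair.toPConf)).comp
      PlanarPair.homotopic_ofFrame_toFrame).trans hy⟩
  rw [hψ]
  exact hP.comp_left PConf.toPlanarPair

lemma pathConnectedSpace_puncturedPlane : PathConnectedSpace puncturedPlane := by
  have h : puncturedPlane = ({(0, 0), (1, 0)} : Set (ℝ × ℝ))ᶜ := by
    ext ζ
    simp [mem_puncturedPlane_iff]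
  rw [← isPathConnected_iff_pathConnectedSpace, h]
  refine Set.Countable.isPathConnected_compl_of_one_lt_rank ?_ (by simp)
  simp only [rank_prod', Module.rank_self]
  norm_num

lemma PConf.homotopic (φ ψ : C(PConf 3 Sphere2, puncturedPlane)) : φ.Homotopic ψ := by
  have := pathConnectedSpace_puncturedPlane
  obtain ⟨y, hy⟩ := PConf.nullhomotopic φ
  obtain ⟨y', hy'⟩ := PConf.nullhomotopic ψ
  obtain ⟨γ⟩ := PathConnectedSpace.joined y y'
  refine hy.trans (ContinuousMap.Homotopic.trans ⟨?_⟩ hy'.symm)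
  exact {
    toFun := fun z => γ z.1
    continuous_toFun := by fun_prop
    map_zero_left := fun _ => γ.source
    map_one_left := fun _ => γ.target }

/-- Add a fourth point with prescribed planar coordinates to a configuration of three points. -/
noncomputable def PConf.addPoint : C(PConf 3 Sphere2 × puncturedPlane, PConf 4 Sphere2) where
  toFun y := ⟨Fin.cons (y.1.toPlanarPair.lift _ (y.1.toPlanarPair.inner_planePoint y.2)) y.1.1, by
    refine Fin.cons_injective_iff.2 ⟨?_, y.1.2⟩
    obtain ⟨h0, h1⟩ := mem_puncturedPlane_iff.1 y.2.2
    rintro ⟨i, hi⟩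
    replace hi := (congrFun (congrArg Subtype.val y.1.toPConf_toPlanarPair) i).trans hi
    fin_cases i
    · exact stereoLift_ne y.1.toPlanarPair.2.1 (y.1.toPlanarPair.inner_planePoint y.2)
        (congrArg Subtype.val hi).symm
    · refine h0 (y.1.toPlanarPair.planePoint_injective ?_)
      rw [PlanarPair.planePoint_zero]
      exact (PlanarPair.lift_injective _ y.1.toPlanarPair.2.2.1 _ hi).symm
    · refine h1 (y.1.toPlanarPair.planePoint_injective ?_)
      rw [PlanarPair.planePoint_one]
      exact (PlanarPair.lift_injective _ y.1.toPlanarPair.inner_add_eq_zero _ hi).symm⟩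
  continuous_toFun := by
    have h : Continuous fun y : PConf 3 Sphere2 × puncturedPlane => y.1.toPlanarPair :=
      PConf.toPlanarPair.continuous.comp continuous_fst
    have h' : Continuous fun y : PConf 3 Sphere2 × puncturedPlane =>
        y.1.toPlanarPair.lift _ (y.1.toPlanarPair.inner_planePoint y.2) :=
      Continuous.subtype_mk (continuous_stereoLift (continuous_subtype_val.comp h).fst
        (PlanarPair.continuous_planePoint.comp
          (h.prodMk (continuous_subtype_val.comp continuous_snd)))) _
    exact Continuous.subtype_mk (Continuous.finCons (A := fun _ => Sphere2) h'
      (continuous_subtype_val.comp continuous_fst)) _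

lemma PConf.addPoint_zero (y : PConf 3 Sphere2 × puncturedPlane) :
    ((PConf.addPoint y).1 0 : E³) =
      stereoLift (y.1.1 0 : E³) (y.1.toPlanarPair.planePoint y.2) := rfl

lemma PConf.addPoint_succ (y : PConf 3 Sphere2 × puncturedPlane) (i : Fin 3) :
    (PConf.addPoint y).1 i.succ = y.1.1 i := rfl

lemma PConf.forgetPoint_addPoint (y : PConf 3 Sphere2 × puncturedPlane) :
    forgetPoint 3 (PConf.addPoint y) = y.1 :=
  Subtype.ext (funext (PConf.addPoint_succ y))

lemma PConf.coe_zero_ne {s : C(PConf 3 Sphere2, PConf 4 Sphere2)}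
    (hs : ∀ x, forgetPoint 3 (s x) = x) (x : PConf 3 Sphere2) (i : Fin 3) :
    ((s x).1 0 : E³) ≠ x.1 i := by
  have hsucc : (s x).1 i.succ = x.1 i := congrFun (congrArg Subtype.val (hs x)) i
  rw [← hsucc]
  exact (s x).coe_ne (Fin.succ_ne_zero i).symm

lemma PConf.exists_stereoLift_eq {s : C(PConf 3 Sphere2, PConf 4 Sphere2)}
    (hs : ∀ x, forgetPoint 3 (s x) = x) :
    ∃ w : C(PConf 3 Sphere2, E³), ∀ x, inner ℝ (w x) x.toPlanarPair.1.1 = 0 ∧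
      stereoLift (x.1 0 : E³) (w x) = (s x).1 0 :=
  ⟨⟨fun x => stereoProj (x.1 0 : E³) ((s x).1 0),
    continuous_stereoProj (PConf.continuous_coe_apply 0)
      ((PConf.continuous_coe_apply 0).comp s.continuous) (fun _ => Sphere2.norm_eq _)
      (fun _ => Sphere2.norm_eq _) (fun x => PConf.coe_zero_ne hs x 0)⟩,
    fun x => ⟨inner_stereoProj (Sphere2.norm_eq _) _,
      stereoLift_stereoProj (Sphere2.norm_eq _) (Sphere2.norm_eq _) (PConf.coe_zero_ne hs x 0)⟩⟩

lemma PConf.exists_eq_addPoint {s : C(PConf 3 Sphere2, PConf 4 Sphere2)}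
    (hs : ∀ x, forgetPoint 3 (s x) = x) :
    ∃ ζ : C(PConf 3 Sphere2, puncturedPlane), ∀ x, s x = PConf.addPoint (x, ζ x) := by
  obtain ⟨w, hw⟩ := PConf.exists_stereoLift_eq hs
  have hcoord (x : PConf 3 Sphere2) :
      x.toPlanarPair.planePoint (x.toPlanarPair.planeCoord (w x)) = w x :=
    x.toPlanarPair.planePoint_planeCoord (hw x).1
  have hmem (x : PConf 3 Sphere2) : x.toPlanarPair.planeCoord (w x) ∈ puncturedPlane := by
    refine mem_puncturedPlane_iff.2 ⟨fun h => ?_, fun h => ?_⟩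
    · have h' := hcoord x
      rw [h, PlanarPair.planePoint_zero] at h'
      exact PConf.coe_zero_ne hs x 1 (by rw [← (hw x).2, ← h', x.stereoLift_toPlanarPair_fst])
    · have h' := hcoord x
      rw [h, PlanarPair.planePoint_one] at h'
      exact PConf.coe_zero_ne hs x 2 (by rw [← (hw x).2, ← h', x.stereoLift_toPlanarPair_add])
  have hcont : Continuous fun x : PConf 3 Sphere2 => x.toPlanarPair.planeCoord (w x) :=
    PlanarPair.continuous_planeCoord.comp (PConf.toPlanarPair.continuous.prodMk w.continuous)
  refine ⟨⟨fun x => ⟨_, hmem x⟩, hcont.subtype_mk _⟩, fun x => Subtype.ext (funext fun i => ?_)⟩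
  refine Fin.cases (Subtype.ext ?_) (fun i => ?_) i
  · rw [PConf.addPoint_zero, ← (hw x).2]
    exact congrArg (stereoLift (x.1 0 : E³)) (hcoord x).symm
  · rw [PConf.addPoint_succ]
    exact congrFun (congrArg Subtype.val (hs x)) i

theorem section_f3_S2_exists_unique_up_to_homotopy :
    (∃ s : C(PConf 3 Sphere2, PConf 4 Sphere2), ∀ x, forgetPoint 3 (s x) = x) ∧
    ∀ s s' : C(PConf 3 Sphere2, PConf 4 Sphere2),
      (∀ x, forgetPoint 3 (s x) = x) → (∀ x, forgetPoint 3 (s' x) = x) →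
        s.Homotopic s' := by
  refine ⟨?_, fun s s' hs hs' => ?_⟩
  · exact ⟨PConf.addPoint.comp ((ContinuousMap.id _).prodMk
      (ContinuousMap.const _ ⟨(2, 0), by simp [mem_puncturedPlane_iff]⟩)),
      fun x => PConf.forgetPoint_addPoint _⟩
  · obtain ⟨ζ, hζ⟩ := PConf.exists_eq_addPoint hs
    obtain ⟨ζ', hζ'⟩ := PConf.exists_eq_addPoint hs'
    have h : s = PConf.addPoint.comp ((ContinuousMap.id _).prodMk ζ) := by
      ext1 x
      exact hζ x
    have h' : s' = PConf.addPoint.comp ((ContinuousMap.id _).prodMk ζ') := by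
      ext1 x
      exact hζ' x
    rw [h, h']
    exact (ContinuousMap.Homotopic.refl _).comp
      ((ContinuousMap.Homotopic.refl _).prodMk (PConf.homotopic ζ ζ'))
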